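/- Let 1 ≤ c ≤ d ≤ g, let Δ^d = {z ∈ ℂ^d : |z_i| < 1} be the open unit polydisc, and let U := {z ∈ Δ^d : z_k ≠ 0 for k = 1, …, c}. Let F, G : Δ^d → ℂ^g be holomorphic, let η : Δ^d → M_g(ℂ) be holomorphic with η(z) symmetric for all z, and let 𝒩¹, …, 𝒩^c ∈ M_g(ℝ) be symmetric. Assume: (i) for every z ∈ U and every m = 1, …, d, ∂G/∂z_m(z) + ε_m·(1/(2πi z_m))·𝒩^m·F(z) = η(z)·∂F/∂z_m(z), where ε_m = 1 if m ≤ c and ε_m = 0 otherwise; (ii) the real symmetric matrix Im η(z) − Σ_{k=1}^c (log|z_k|/2π)·𝒩^k is positive definite for every z ∈ U; (iii) the g×d Jacobian matrix (∂F_i/∂z_m(z)) has rank d for every z ∈ U. Then there exists r ∈ (0, 1) such that no z ∈ U with max_i |z_i| < r satisfies both Im F(z) = 0 and Im G(z) − Σ_{k=1}^c (log|z_k|/2π)·𝒩^k·Re F(z) = 0. -/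

import Mathlib

open Set Matrix


theorem vd_descent {M : Type*} [Field M] [Algebra ℂ M] (v : Valuation M (WithZero (Multiplicative ℤ)))
    (δ : Derivation ℂ M M) (t : M) (ht0 : t ≠ 0) (ht : v t < 1) (hδt : δ t = t)
    (hvc : ∀ c : ℂ, c ≠ 0 → v (algebraMap ℂ M c) = 1)
    (hπ : ∃ π : M, v π = WithZero.exp (-1 : ℤ))
    (hres : ∀ x, v x ≤ 1 → ∃ c : ℂ, v (x - algebraMap ℂ M c) < 1)
    (N : ℕ) (hN : ∀ x, v x ≤ 1 → v (δ x) ≤ WithZero.exp (N : ℤ)) :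
    (∀ x, v x ≤ 1 → v (δ x) < 1) ∧ (∀ x, v x < 1 → v (δ x) = v x) := by
  have key : ∀ x, x ≠ 0 → ∃ e : ℕ, e ≠ 0 ∧ ∃ k : ℤ, ∃ y : M, v y = 1 ∧ (v x < 1 → k ≠ 0) ∧
      (e : M) * (δ x / x) = k + δ y / y := by
    intro x hx
    have hvx : v x ≠ 0 := (Valuation.ne_zero_iff v).2 hx
    have hvt : v t ≠ 0 := (Valuation.ne_zero_iff v).2 ht0
    obtain ⟨e, he⟩ : ∃ e : ℤ, e = - WithZero.log (v t) := ⟨_, rfl⟩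
    obtain ⟨k, hk⟩ : ∃ k : ℤ, k = - WithZero.log (v x) := ⟨_, rfl⟩
    have hvt' : v t = WithZero.exp (-e) := by rw [he, neg_neg, WithZero.exp_log hvt]
    have hvx' : v x = WithZero.exp (-k) := by rw [hk, neg_neg, WithZero.exp_log hvx]
    have hepos : 0 < e := by
      rw [hvt', ← WithZero.exp_zero, WithZero.exp_lt_exp] at ht
      omega
    clear he hk
    obtain ⟨e', rfl⟩ : ∃ e' : ℕ, e = e' := ⟨e.toNat, by omega⟩
    refine ⟨e', by omega, k, x ^ e' * (t ^ k)⁻¹, ?_, ?_, ?_⟩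
    · rw [map_mul, map_pow, map_inv₀, map_zpow₀, hvt', hvx', ← WithZero.exp_nsmul,
        ← WithZero.exp_zsmul, ← WithZero.exp_neg, ← WithZero.exp_add, WithZero.exp_eq_one]
      simp; ring
    · intro h
      rw [hvx', ← WithZero.exp_zero, WithZero.exp_lt_exp] at h
      omega
    · have h1 : δ (x ^ e') = (e' : M) * (δ x / x) * x ^ e' := by
        rw [Derivation.leibniz_pow]
        rcases e' with _ | e'
        · simp
        · simp only [add_tsub_cancel_right, smul_eq_mul, nsmul_eq_mul]
          field_simp
          ring
      have hpow : ∀ n : ℕ, δ (t ^ n) = (n : M) * t ^ n := by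
        intro n
        rw [Derivation.leibniz_pow, hδt]
        rcases n with _ | n
        · simp
        · simp only [add_tsub_cancel_right, smul_eq_mul, nsmul_eq_mul]
          ring
      have h2 : δ ((t ^ k)⁻¹) = -(k : M) * (t ^ k)⁻¹ := by
        rcases k with n | n
        · rw [Derivation.leibniz_inv]
          simp only [Int.ofNat_eq_natCast, zpow_natCast, hpow, smul_eq_mul, Int.cast_natCast]
          field_simp
        · rw [zpow_negSucc, inv_inv, hpow]
          push_cast
          ring
      rw [Derivation.leibniz, h1, h2]
      simp only [smul_eq_mul]
      have : t ^ k ≠ 0 := zpow_ne_zero _ ht0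
      field_simp
      ring
  have hcast : ∀ e : ℤ, e ≠ 0 → v (e : M) = 1 := by
    intro e he
    have := hvc (e : ℂ) (by exact_mod_cast he)
    simpa using this
  have hcastle : ∀ e : ℤ, v (e : M) ≤ 1 := by
    intro e
    by_cases he : e = 0
    · simp [he]
    · exact (hcast e he).le
  obtain ⟨π, hπ⟩ := hπ
  have hπ0 : π ≠ 0 := by
    rintro rfl
    rw [map_zero] at hπ
    exact WithZero.exp_ne_zero hπ.symm
  have step : ∀ n : ℕ, (∀ x, v x ≤ 1 → v (δ x) ≤ WithZero.exp (n : ℤ)) →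
      ∀ x, v x ≤ 1 → v (δ x) ≤ WithZero.exp ((n : ℤ) - 1) := by
    intro n hn x hx
    obtain ⟨c, hc⟩ := hres x hx
    set y := (x - algebraMap ℂ M c) / π with hy
    have hxy : x = algebraMap ℂ M c + π * y := by rw [hy]; field_simp; ring
    have hvy : v y ≤ 1 := by
      rw [hy, map_div₀, hπ]
      by_cases h0 : v (x - algebraMap ℂ M c) = 0
      · rw [h0]; simp
      · rw [← WithZero.exp_log h0] at hc ⊢
        rw [← WithZero.exp_zero, WithZero.exp_lt_exp] at hc
        rw [← WithZero.exp_sub, ← WithZero.exp_zero, WithZero.exp_le_exp]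
        omega
    have hδπ : v (δ π) ≤ WithZero.exp ((n : ℤ) - 1) := by
      obtain ⟨e, he, k, u, hu, -, heq⟩ := key π hπ0
      have h1 : v ((e : M) * (δ π / π)) ≤ WithZero.exp (n : ℤ) := by
        rw [heq]
        refine (v.map_add _ _).trans (max_le ?_ ?_)
        · refine (hcastle k).trans ?_
          rw [← WithZero.exp_zero, WithZero.exp_le_exp]; omega
        · rw [map_div₀, hu, div_one]; exact hn u hu.le
      rw [map_mul] at h1
      have := hcast e (by exact_mod_cast he)
      rw [Int.cast_natCast] at this
      rw [this, one_mul, map_div₀, hπ] at h1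
      calc v (δ π) = v (δ π) / WithZero.exp (-1 : ℤ) * WithZero.exp (-1 : ℤ) := by
            rw [div_mul_cancel₀]; exact WithZero.exp_ne_zero
        _ ≤ WithZero.exp (n : ℤ) * WithZero.exp (-1 : ℤ) := mul_le_mul_left h1 _
        _ = _ := by rw [← WithZero.exp_add]; rfl
    have : δ x = π * δ y + y * δ π := by
      conv_lhs => rw [hxy]
      simp
    rw [this]
    refine (v.map_add _ _).trans (max_le ?_ ?_)
    · rw [map_mul, hπ, sub_eq_add_neg, add_comm, WithZero.exp_add]
      exact mul_le_mul_right (hn y hvy) _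
    · rw [map_mul]
      calc v y * v (δ π) ≤ 1 * WithZero.exp ((n : ℤ) - 1) := mul_le_mul' hvy hδπ
        _ = _ := one_mul _
  have desc : ∀ n : ℕ, ∀ x, v x ≤ 1 → v (δ x) ≤ WithZero.exp ((N - n : ℕ) : ℤ) := by
    intro n
    induction n with
    | zero => simpa using hN
    | succ n ih =>
      by_cases h : N - n = 0
      · have : N - (n+1) = N - n := by omega
        rw [this]; exact ih
      · intro x hx
        have := step _ ih x hx
        have h2 : ((N - n : ℕ) : ℤ) - 1 = ((N - (n + 1) : ℕ) : ℤ) := by omega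
        rwa [h2] at this
  have main : ∀ x, v x ≤ 1 → v (δ x) < 1 := by
    intro x hx
    have h0 := desc N
    rw [Nat.sub_self] at h0
    refine (step 0 h0 x hx).trans_lt ?_
    rw [← WithZero.exp_zero, WithZero.exp_lt_exp]; norm_num
  refine ⟨main, ?_⟩
  intro x hx
  by_cases hx0 : x = 0
  · simp [hx0]
  obtain ⟨e, he, k, u, hu, hk, heq⟩ := key x hx0
  have h1 : v ((k : M) + δ u / u) = 1 := by
    rw [Valuation.map_add_eq_of_lt_left]
    · exact hcast k (hk hx)
    · rw [hcast k (hk hx), map_div₀, hu, div_one]; exact main u hu.le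
  rw [← heq, map_mul] at h1
  have := hcast e (by exact_mod_cast he)
  rw [Int.cast_natCast] at this
  rw [this, one_mul, map_div₀] at h1
  exact (div_eq_one_iff_eq ((Valuation.ne_zero_iff v).2 hx0)).1 h1

open scoped TensorProduct in
theorem exists_derivation {D M : Type} [CommRing D] [Algebra ℂ D] [Field M] [Algebra ℂ M] [Algebra D M]
   [IsScalarTower ℂ D M] [Algebra.FormallyEtale D M] (d : Derivation ℂ D D) :
   ∃ δ : Derivation ℂ M M, ∀ a, δ (algebraMap D M a) = algebraMap D M (d a) := by
  let d0 : Derivation ℂ D M := (Algebra.linearMap D M).compDer d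
  let l : M ⊗[D] Ω[D⁄ℂ] →ₗ[M] M := LinearMap.liftBaseChange M d0.liftKaehlerDifferential
  refine ⟨(l ∘ₗ (KaehlerDifferential.tensorKaehlerEquivOfFormallyEtale ℂ D M).symm.toLinearMap).compDer
    (KaehlerDifferential.D ℂ M), fun a => ?_⟩
  simp only [Derivation.coe_comp, LinearMap.coe_comp, Function.comp_apply,
    LinearMap.coe_restrictScalars, Derivation.coeFn_coe, LinearEquiv.coe_coe]
  rw [KaehlerDifferential.tensorKaehlerEquivOfFormallyEtale_symm_D_algebraMap]
  simp [l, d0]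

theorem exists_valued (M : Type) [Field M] [Algebra (PowerSeries ℂ) M]
    [Algebra (FractionRing (PowerSeries ℂ)) M]
    [IsScalarTower (PowerSeries ℂ) (FractionRing (PowerSeries ℂ)) M]
    [FiniteDimensional (FractionRing (PowerSeries ℂ)) M]
    [Algebra ℂ M] [IsScalarTower ℂ (PowerSeries ℂ) M] :
    ∃ (v : Valuation M (WithZero (Multiplicative ℤ))) (δ : Derivation ℂ M M),
      (∀ x, IsIntegral (PowerSeries ℂ) x → v x ≤ 1) ∧
      (∀ c : ℂ, c ≠ 0 → v (algebraMap ℂ M c) = 1) ∧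
      (∀ x, v x ≤ 1 → ∃ c : ℂ, v (x - algebraMap ℂ M c) < 1) ∧
      (∀ x, v x ≤ 1 → v (δ x) < 1) ∧ (∀ x, v x < 1 → v (δ x) = v x) := by
  let D := PowerSeries ℂ
  let K := FractionRing D
  have : CharZero K := algebraRat.charZero K
  have hDK : Algebra.FormallyEtale D K := Algebra.FormallyEtale.of_isLocalization (nonZeroDivisors D)
  have hKM : Algebra.FormallyEtale K M := Algebra.FormallyEtale.of_isSeparable K M
  have hDM : Algebra.FormallyEtale D M := Algebra.FormallyEtale.comp D K M
  obtain ⟨δ, hδ⟩ := exists_derivation (D := D) (M := M) ((PowerSeries.X : D) • PowerSeries.derivative ℂ)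
  let B := integralClosure D M
  have hBdd : IsDedekindDomain B := integralClosure.isDedekindDomain D K M
  have hBfr : IsFractionRing B M := integralClosure.isFractionRing_of_finite_extension K M
  have hBfin : Module.Finite D B := IsIntegralClosure.finite D K M B
  have hDMinj : Function.Injective (algebraMap D M) := by
    rw [IsScalarTower.algebraMap_eq D K M]
    exact (algebraMap K M).injective.comp (IsFractionRing.injective D K)
  have hDBinj : Function.Injective (algebraMap D B) := by
    have : algebraMap D M = (algebraMap B M).comp (algebraMap D B) := IsScalarTower.algebraMap_eq D B M
    have h2 := hDMinj
    rw [this, RingHom.coe_comp] at h2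
    exact Function.Injective.of_comp h2
  have hIntg : Algebra.IsIntegral D B := inferInstance
  obtain ⟨𝔭, h𝔭, h𝔭D⟩ := Ideal.exists_ideal_over_maximal_of_isIntegral (S := B)
    (IsLocalRing.maximalIdeal D) (by rw [(RingHom.injective_iff_ker_eq_bot _).1 hDBinj]; exact bot_le)
  have hX𝔭 : algebraMap D B PowerSeries.X ∈ 𝔭 := by
    rw [← Ideal.mem_comap, h𝔭D, PowerSeries.maximalIdeal_eq_span_X]
    exact Ideal.mem_span_singleton_self _
  have h𝔭0 : 𝔭 ≠ ⊥ := by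
    rintro rfl
    rw [Ideal.mem_bot, map_eq_zero_iff _ hDBinj] at hX𝔭
    exact PowerSeries.X_ne_zero hX𝔭
  let w : IsDedekindDomain.HeightOneSpectrum B := ⟨𝔭, h𝔭.isPrime, h𝔭0⟩
  let v := w.valuation M
  have hvB : ∀ b : B, v (algebraMap B M b) ≤ 1 := w.valuation_le_one
  have hvint : ∀ x, IsIntegral D x → v x ≤ 1 := fun x hx => hvB ⟨x, hx⟩
  have hvc : ∀ c : ℂ, c ≠ 0 → v (algebraMap ℂ M c) = 1 := by
    intro c hc
    have h1 : ∀ c : ℂ, v (algebraMap ℂ M c) ≤ 1 := by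
      intro c
      apply hvint
      rw [IsScalarTower.algebraMap_apply ℂ D M]
      exact isIntegral_algebraMap
    refine le_antisymm (h1 c) ?_
    have h2 := h1 c⁻¹
    rw [map_inv₀, map_inv₀] at h2
    have h3 : v (algebraMap ℂ M c) ≠ 0 := by
      rw [Valuation.ne_zero_iff]; simpa using hc
    exact (inv_le_one₀ (zero_lt_iff.2 h3)).1 h2
  have hvD : ∀ a : D, v (algebraMap D M a) ≤ 1 := fun a => hvint _ isIntegral_algebraMap
  have hres : ∀ x, v x ≤ 1 → ∃ c : ℂ, v (x - algebraMap ℂ M c) < 1 := by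
    intro x hx
    obtain ⟨b, hb⟩ := w.exists_valuation_sub_lt_of_integer (K := M) hx 1
    let _ : Field (B ⧸ 𝔭) := Ideal.Quotient.field 𝔭
    have hsur : Function.Surjective (algebraMap ℂ (B ⧸ 𝔭)) := by
      have hDκ : ∀ a : D, algebraMap D (B ⧸ 𝔭) a = algebraMap ℂ (B ⧸ 𝔭) (PowerSeries.constantCoeff a) := by
        intro a
        have : algebraMap ℂ D (PowerSeries.constantCoeff a) = PowerSeries.C (PowerSeries.constantCoeff a) := rfl
        rw [IsScalarTower.algebraMap_apply ℂ D (B ⧸ 𝔭), this]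
        conv_lhs => rw [PowerSeries.eq_X_mul_shift_add_const a]
        rw [map_add, map_mul]
        have : algebraMap D (B ⧸ 𝔭) PowerSeries.X = 0 := by
          rw [IsScalarTower.algebraMap_apply D B (B ⧸ 𝔭)]
          exact Ideal.Quotient.eq_zero_iff_mem.2 hX𝔭
        rw [this, zero_mul, zero_add]
      have hi : Algebra.IsIntegral ℂ (B ⧸ 𝔭) := by
        constructor
        intro y
        obtain ⟨p, hp, hpy⟩ := (Algebra.IsIntegral.isIntegral (R := D) y)
        refine ⟨p.map PowerSeries.constantCoeff, hp.map _, ?_⟩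
        rw [Polynomial.eval₂_map]
        have hcomp : (algebraMap ℂ (B ⧸ 𝔭)).comp PowerSeries.constantCoeff = algebraMap D (B ⧸ 𝔭) :=
          RingHom.ext fun a => (hDκ a).symm
        rw [hcomp]
        exact hpy
      exact (IsAlgClosed.algebraMap_bijective_of_isIntegral (k := ℂ) (K := B ⧸ 𝔭)).2
    obtain ⟨c, hc⟩ := hsur (Ideal.Quotient.mk 𝔭 b)
    refine ⟨c, ?_⟩
    have h1 : v (algebraMap B M (b - algebraMap ℂ B c)) < 1 := by
      rw [w.valuation_lt_one_iff_mem]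
      apply (Ideal.Quotient.eq (I := 𝔭)).1
      rw [← hc]; rfl
    have h2 : x - algebraMap ℂ M c = algebraMap B M (b - algebraMap ℂ B c) - (algebraMap B M b - x) := by
      rw [map_sub, ← IsScalarTower.algebraMap_apply ℂ B M]; ring
    rw [h2]
    exact v.map_sub_lt h1 hb
  have hδD : ∀ a : D, v (δ (algebraMap D M a)) ≤ 1 := fun a => by rw [hδ]; exact hvD _
  obtain ⟨N, hN⟩ : ∃ N : ℕ, ∀ b : B, v (δ (algebraMap B M b)) ≤ WithZero.exp (N : ℤ) := by
    obtain ⟨s, hs⟩ := hBfin.fg_top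
    have hexp : ∀ x : WithZero (Multiplicative ℤ), ∃ n : ℕ, x ≤ WithZero.exp (n : ℤ) := by
      intro x
      by_cases hx : x = 0
      · exact ⟨0, by simp [hx]⟩
      · refine ⟨(WithZero.log x).toNat, ?_⟩
        conv_lhs => rw [← WithZero.exp_log hx]
        rw [WithZero.exp_le_exp]; omega
    choose n hn using fun b : B => hexp (v (δ (algebraMap B M b)))
    refine ⟨s.sup n, fun b => ?_⟩
    have hb : b ∈ Submodule.span D (s : Set B) := by rw [hs]; trivial
    have hone : (1 : WithZero (Multiplicative ℤ)) ≤ WithZero.exp ((s.sup n : ℕ) : ℤ) := by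
      rw [← WithZero.exp_zero, WithZero.exp_le_exp]; omega
    induction hb using Submodule.span_induction with
    | mem b hb =>
      refine (hn b).trans ?_
      rw [WithZero.exp_le_exp]
      exact_mod_cast Finset.le_sup (f := n) hb
    | zero => simp
    | add x y _ _ hx hy =>
      rw [map_add, map_add]
      exact (v.map_add _ _).trans (max_le hx hy)
    | smul a x _ hx =>
      rw [Algebra.smul_def, map_mul, ← IsScalarTower.algebraMap_apply D B M, Derivation.leibniz]
      refine (v.map_add _ _).trans (max_le ?_ ?_)
      · rw [smul_eq_mul, map_mul]
        exact (mul_le_mul' (hvD a) hx).trans_eq (one_mul _)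
      · rw [smul_eq_mul, map_mul]
        exact ((mul_le_mul' (hvB x) (hδD a)).trans_eq (one_mul _)).trans hone
  refine ⟨v, δ, hvint, hvc, hres, ?_⟩
  refine vd_descent v δ (algebraMap D M PowerSeries.X) ?_ ?_ ?_ hvc (w.valuation_exists_uniformizer M) hres N ?_
  · rw [Ne, map_eq_zero_iff _ hDMinj]; exact PowerSeries.X_ne_zero
  · rw [IsScalarTower.algebraMap_apply D B M]
    exact (w.valuation_lt_one_iff_mem _).2 hX𝔭
  · rw [hδ]
    have hX : ((PowerSeries.X : D) • PowerSeries.derivative ℂ) (PowerSeries.X : D) = PowerSeries.X := by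
      rw [Derivation.smul_apply]
      erw [PowerSeries.derivative_X]
      rw [smul_eq_mul, mul_one]
    rw [hX]
  · intro x hx
    obtain ⟨a, ⟨b, hb⟩, hab⟩ := w.exists_primeCompl_mul_eq_of_integer x hx
    have hvb : v (algebraMap B M b) = 1 := by
      rw [w.valuation_eq_one_iff_notMem]; exact hb
    have h1 := congrArg δ hab
    rw [Derivation.leibniz] at h1
    simp only [smul_eq_mul] at h1
    have h2 : algebraMap B M b * δ x = δ (algebraMap B M a) - x * δ (algebraMap B M b) := by
      rw [← h1]; ring
    have h3 : v (δ x) = v (algebraMap B M b * δ x) := by rw [map_mul, hvb, one_mul]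
    rw [h3, h2]
    refine (v.map_sub _ _).trans (max_le (hN a) ?_)
    rw [map_mul]
    exact (mul_le_mul' hx (hN b)).trans_eq (one_mul _)


theorem lift_analytic {E F : Type}
    [NormedAddCommGroup E] [NormedSpace ℂ E] [NormedAddCommGroup F] [NormedSpace ℂ F] [CompleteSpace F]
    (f : E → F) (hf : AnalyticAt ℂ f 0) :
    ∃ R > 0, ∀ (K : Type) [TopologicalSpace K] [CompactSpace K], ∃ Φ : C(K, E) → C(K, F), AnalyticOnNhd ℂ Φ (Metric.ball 0 R) ∧
      ∀ γ ∈ Metric.ball (0 : C(K, E)) R, ∀ k, Φ γ k = f (γ k) := by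
  obtain ⟨p, r, hp⟩ := hf
  obtain ⟨R, hR0, hRr⟩ : ∃ R : NNReal, 0 < R ∧ (R : ENNReal) < r := by
    obtain ⟨R, h1, h2⟩ := ENNReal.lt_iff_exists_nnreal_btwn.1 hp.r_pos
    exact ⟨R, by exact_mod_cast h1, h2⟩
  refine ⟨R, by exact_mod_cast hR0, fun K _ _ => ?_⟩
  let q : FormalMultilinearSeries ℂ C(K, E) C(K, F) := fun n =>
    MultilinearMap.mkContinuous
      { toFun := fun m => ⟨fun k => p n (fun i => m i k), by fun_prop⟩
        map_update_add' := by
          intro _ m i x y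
          ext k
          have : ∀ z : C(K, E), (fun j => (Function.update m i z) j k) = Function.update (fun j => m j k) i (z k) := by
            intro z; ext j; by_cases h : j = i
            · subst h; simp
            · simp [h]
          simp [this]
        map_update_smul' := by
          intro _ m i c x
          ext k
          have : ∀ z : C(K, E), (fun j => (Function.update m i z) j k) = Function.update (fun j => m j k) i (z k) := by
            intro z; ext j; by_cases h : j = i
            · subst h; simp
            · simp [h]
          simp [this] } ‖p n‖ (by
      intro m
      refine (ContinuousMap.norm_le _ (by positivity)).2 fun k => ?_
      refine ((p n).le_opNorm _).trans ?_
      gcongr with i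
      exact (m i).norm_coe_le_norm k)
  have hq : ∀ n (m : Fin n → C(K, E)) k, q n m k = p n (fun i => m i k) := fun n m k => rfl
  have hqn : ∀ n, ‖q n‖ ≤ ‖p n‖ := fun n => MultilinearMap.mkContinuous_norm_le _ (norm_nonneg _) _
  have hsum : Summable fun n => ‖q n‖ * (R : ℝ) ^ n := by
    refine Summable.of_nonneg_of_le (fun n => by positivity) (fun n => ?_)
      (p.summable_norm_mul_pow (hRr.trans_le hp.r_le))
    gcongr
    exact hqn n
  have hrad : (R : ENNReal) ≤ q.radius := q.le_radius_of_summable hsum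
  have hR0' : (0 : ENNReal) < R := by exact_mod_cast hR0
  have hqs := (q.hasFPowerSeriesOnBall (hR0'.trans_le hrad)).mono hR0' hrad
  refine ⟨q.sum, ?_, ?_⟩
  · have := hqs.analyticOnNhd
    rwa [Metric.eball_coe] at this
  · intro γ hγ k
    have h1 := hqs.hasSum (y := γ) (by rw [Metric.eball_coe]; exact hγ)
    rw [zero_add] at h1
    have h2 := h1.map (ContinuousMap.evalCLM ℂ k : C(K, F) →L[ℂ] F) (ContinuousLinearMap.continuous _)
    have h3 := hp.hasSum (y := γ k) (by
      refine Metric.eball_subset_eball hRr.le ?_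
      rw [Metric.eball_coe, mem_ball_zero_iff] at *
      exact (γ.norm_coe_le_norm k).trans_lt hγ)
    rw [zero_add] at h3
    exact h2.unique h3

theorem lift_analytic2 {E : Type} [NormedAddCommGroup E] [NormedSpace ℂ E]
    (f : E × ℂ → ℂ) (hf : AnalyticAt ℂ f 0) :
    ∃ R > 0, ∀ ρ, 0 < ρ → ρ < R → ∃ φ : E → C(Metric.sphere (0:ℂ) ρ, ℂ), AnalyticAt ℂ φ 0 ∧
      ∀ᶠ x in nhds 0, ∀ ζ : Metric.sphere (0:ℂ) ρ, φ x ζ = f (x, ζ) := by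
  obtain ⟨R, hR, H⟩ := lift_analytic f hf
  refine ⟨R, hR, fun ρ hρ hρR => ?_⟩
  obtain ⟨Φ, hΦ, hΦf⟩ := H (Metric.sphere (0:ℂ) ρ)
  let L : E →L[ℂ] C(Metric.sphere (0:ℂ) ρ, E × ℂ) := LinearMap.mkContinuous
    { toFun := fun x => ContinuousMap.const _ (x, 0)
      map_add' := fun x y => by ext k <;> simp
      map_smul' := fun x y => by ext k <;> simp } 1 (by
    intro x
    refine (ContinuousMap.norm_le _ (by positivity)).2 fun k => ?_
    simp)
  let γ0 : C(Metric.sphere (0:ℂ) ρ, E × ℂ) := ⟨fun k => (0, k), by fun_prop⟩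
  have hL : ∀ x k, (L x + γ0) k = (x, (k : ℂ)) := by
    intro x k
    change ((x, 0) : E × ℂ) + (0, (k:ℂ)) = _
    simp
  have hγ0 : ‖γ0‖ < R := by
    refine lt_of_le_of_lt ((ContinuousMap.norm_le _ hρ.le).2 fun k => ?_) hρR
    change ‖((0 : E), (k : ℂ))‖ ≤ ρ
    have : ‖(k : ℂ)‖ = ρ := by simp
    simp [Prod.norm_def, this, hρ.le]
  have han : AnalyticAt ℂ (fun x => L x + γ0) 0 := (L.analyticAt 0).add analyticAt_const
  refine ⟨fun x => Φ (L x + γ0), ?_, ?_⟩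
  · refine AnalyticAt.fun_comp (hΦ _ ?_) han
    simpa using hγ0
  · have hc : Filter.Tendsto (fun x => L x + γ0) (nhds 0) (nhds (L 0 + γ0)) := han.continuousAt
    have : ∀ᶠ x in nhds 0, L x + γ0 ∈ Metric.ball 0 R := by
      refine hc.eventually (Metric.isOpen_ball.mem_nhds ?_)
      simpa using hγ0
    filter_upwards [this] with x hx ζ
    rw [hΦf _ hx, hL]

theorem exists_circCLM (ρ : ℝ) (hρ : 0 < ρ) : ∃ J : C(Metric.sphere (0:ℂ) ρ, ℂ) →L[ℂ] ℂ,
    ∀ (φ : C(Metric.sphere (0:ℂ) ρ, ℂ)) (f : ℂ → ℂ),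
    (∀ ζ : Metric.sphere (0:ℂ) ρ, φ ζ = f ζ) → J φ = ∮ ζ in C(0, ρ), f ζ := by
  classical
  have hci : ∀ φ : C(Metric.sphere (0:ℂ) ρ, ℂ), CircleIntegrable
      (fun ζ : ℂ => if h : ζ ∈ Metric.sphere (0:ℂ) ρ then φ ⟨ζ, h⟩ else 0) 0 ρ := by
    intro φ
    refine ContinuousOn.circleIntegrable hρ.le ?_
    rw [continuousOn_iff_continuous_domRestrict]
    convert φ.continuous using 1
    ext ζ
    rw [Set.domRestrict_apply, dif_pos ζ.2]
  let J : C(Metric.sphere (0:ℂ) ρ, ℂ) →L[ℂ] ℂ := LinearMap.mkContinuous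
    { toFun := fun φ => ∮ ζ in C(0, ρ), if h : ζ ∈ Metric.sphere (0:ℂ) ρ then φ ⟨ζ, h⟩ else 0
      map_add' := fun φ ψ => by
        rw [← circleIntegral.integral_add (hci φ) (hci ψ)]
        congr 1; ext ζ; split_ifs <;> simp
      map_smul' := fun a φ => by
        rw [RingHom.id_apply, ← circleIntegral.integral_smul]
        congr 1; ext ζ; split_ifs <;> simp } (2 * Real.pi * ρ) (by
    intro φ
    change ‖circleIntegral (fun ζ : ℂ => if h : ζ ∈ Metric.sphere (0:ℂ) ρ then φ ⟨ζ, h⟩ else 0) 0 ρ‖ ≤ _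
    refine circleIntegral.norm_integral_le_of_norm_le_const hρ.le fun ζ hζ => ?_
    rw [dif_pos hζ]
    exact φ.norm_coe_le_norm _)
  refine ⟨J, fun φ f h => ?_⟩
  change circleIntegral (fun ζ : ℂ => if h : ζ ∈ Metric.sphere (0:ℂ) ρ then φ ⟨ζ, h⟩ else 0) 0 ρ =
    circleIntegral f 0 ρ
  refine circleIntegral.integral_congr hρ.le fun ζ hζ => ?_
  simp only [dif_pos hζ]
  exact h ⟨ζ, hζ⟩

theorem weier_one (ρ ρ' : ℝ) (hρ : 0 < ρ) (hρ' : ρ < ρ') (s : ℕ) (ψ h : ℂ → ℂ) (ε : ℝ)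
    (hψ : DifferentiableOn ℂ ψ (Metric.ball 0 ρ')) (hh : DifferentiableOn ℂ h (Metric.ball 0 ρ'))
    (hε1 : ε < ρ ^ s) (hε2 : ε * (2 / ρ) ^ s < 1)
    (hψε : ∀ ζ ∈ Metric.sphere (0:ℂ) ρ, ‖ψ ζ - ζ ^ s‖ ≤ ε)
    (hIntg : ∀ j < s, (∮ ζ in C(0, ρ), h ζ / ψ ζ * ζ ^ j) = 0) :
    ∀ z ∈ Metric.ball (0:ℂ) ρ, ψ z = 0 → h z = 0 := by
  have hcb : Metric.closedBall (0:ℂ) ρ ⊆ Metric.ball 0 ρ' := Metric.closedBall_subset_ball hρ'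
  have hsb : Metric.sphere (0:ℂ) ρ ⊆ Metric.ball 0 ρ' := Metric.sphere_subset_closedBall.trans hcb
  have hε0 : 0 ≤ ε := by
    refine (norm_nonneg _).trans (hψε ρ ?_)
    simp [abs_of_pos hρ]
  have hψ0 : ∀ ζ ∈ Metric.sphere (0:ℂ) ρ, ψ ζ ≠ 0 := by
    intro ζ hζ h0
    have h1 := hψε ζ hζ
    rw [h0, zero_sub, norm_neg, norm_pow, mem_sphere_zero_iff_norm.1 hζ] at h1
    linarith
  have hQ : ContinuousOn (fun ζ => h ζ / ψ ζ) (Metric.sphere (0:ℂ) ρ) :=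
    (hh.continuousOn.mono hsb).div (hψ.continuousOn.mono hsb) hψ0
  obtain ⟨C, hC⟩ := (isCompact_sphere (0:ℂ) ρ).exists_bound_of_continuousOn hQ
  set Λ : (ℂ → ℂ) → ℂ := fun φ => ∮ ζ in C(0, ρ), h ζ / ψ ζ * φ ζ with hΛ
  have hC0 : 0 ≤ C := (norm_nonneg _).trans (hC ρ (by simp [abs_of_pos hρ]))
  have hΛb : ∀ φ : ℂ → ℂ, ∀ B, (∀ ζ ∈ Metric.sphere (0:ℂ) ρ, ‖φ ζ‖ ≤ B) →
      ‖Λ φ‖ ≤ 2 * Real.pi * ρ * (C * B) := by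
    intro φ B hB
    refine circleIntegral.norm_integral_le_of_norm_le_const hρ.le fun ζ hζ => ?_
    rw [norm_mul]
    exact mul_le_mul (hC ζ hζ) (hB ζ hζ) (norm_nonneg _) hC0
  have hΛi : ∀ φ : ℂ → ℂ, DifferentiableOn ℂ φ (Metric.ball 0 ρ') →
      CircleIntegrable (fun ζ => h ζ / ψ ζ * φ ζ) 0 ρ := fun φ hφ =>
    ContinuousOn.circleIntegrable hρ.le (hQ.mul (hφ.continuousOn.mono hsb))
  have hdiffpow : ∀ (j : ℕ) (φ : ℂ → ℂ), DifferentiableOn ℂ φ (Metric.ball 0 ρ') →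
      DifferentiableOn ℂ (fun ζ => ζ ^ j * φ ζ) (Metric.ball 0 ρ') := fun j φ hφ =>
    ((differentiable_id.pow j).differentiableOn).mul hφ
  have hρ'0 : (0:ℝ) < ρ' := hρ.trans hρ'
  -- shift step
  have shift : ∀ (φ : ℂ → ℂ) (B : ℝ), DifferentiableOn ℂ φ (Metric.ball 0 ρ') →
      (∀ ζ ∈ Metric.sphere (0:ℂ) ρ, ‖φ ζ‖ ≤ B) → ∀ j ≤ s, ∃ φ' : ℂ → ℂ,
      DifferentiableOn ℂ φ' (Metric.ball 0 ρ') ∧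
      (∀ ζ ∈ Metric.sphere (0:ℂ) ρ, ‖φ' ζ‖ ≤ (2 / ρ) ^ j * B) ∧
      Λ φ = Λ (fun ζ => ζ ^ j * φ' ζ) := by
    intro φ B hφ hB j
    induction j with
    | zero => exact fun _ => ⟨φ, hφ, by simpa using hB, by simp⟩
    | succ j ih =>
      intro hj
      obtain ⟨φ', h1, h2, h3⟩ := ih (by omega)
      have hd : DifferentiableOn ℂ (dslope φ' 0) (Metric.ball 0 ρ') :=
        (Complex.differentiableOn_dslope (Metric.ball_mem_nhds _ hρ'0)).2 h1
      have heq : ∀ ζ, φ' ζ = φ' 0 + ζ * dslope φ' 0 ζ := by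
        intro ζ
        have := sub_smul_dslope φ' 0 ζ
        rw [smul_eq_mul, sub_zero] at this
        rw [this]; ring
      have h0 : ‖φ' 0‖ ≤ (2 / ρ) ^ j * B := by
        refine Complex.norm_le_of_forall_mem_frontier_norm_le (U := Metric.ball 0 ρ)
          Metric.isBounded_ball ((h1.mono ?_).diffContOnCl) ?_ (subset_closure (Metric.mem_ball_self hρ))
        · rw [closure_ball _ hρ.ne']; exact hcb
        · rw [frontier_ball _ hρ.ne']; exact h2
      refine ⟨dslope φ' 0, hd, ?_, ?_⟩
      · intro ζ hζ
        have hn := mem_sphere_zero_iff_norm.1 hζ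
        have h4 : ‖ζ * dslope φ' 0 ζ‖ ≤ 2 * ((2 / ρ) ^ j * B) := by
          have : ζ * dslope φ' 0 ζ = φ' ζ - φ' 0 := by rw [heq ζ]; ring
          rw [this]
          refine (norm_sub_le _ _).trans ?_
          linarith [h2 ζ hζ]
        rw [norm_mul, hn] at h4
        rw [pow_succ]
        calc ‖dslope φ' 0 ζ‖ = (ρ * ‖dslope φ' 0 ζ‖) / ρ := by field_simp
          _ ≤ (2 * ((2 / ρ) ^ j * B)) / ρ := by gcongr
          _ = _ := by ring
      · rw [h3]
        have h5 : (fun ζ => ζ ^ j * φ' ζ) = fun ζ => φ' 0 * ζ ^ j + ζ ^ (j + 1) * dslope φ' 0 ζ := by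
          ext ζ
          conv_lhs => rw [heq ζ]
          ring
        simp only [hΛ]
        have h6 : (∮ ζ in C(0, ρ), h ζ / ψ ζ * (ζ ^ j * φ' ζ)) =
            (∮ ζ in C(0, ρ), ((φ' 0) • (h ζ / ψ ζ * ζ ^ j) + h ζ / ψ ζ * (ζ ^ (j + 1) * dslope φ' 0 ζ))) := by
          congr 1; ext ζ
          rw [congrFun h5 ζ, smul_eq_mul]; ring
        rw [h6, circleIntegral.integral_add, circleIntegral.integral_smul, hIntg j (by omega), smul_zero, zero_add]
        · have := hΛi (fun ζ => ζ ^ j) ((differentiable_id.pow j).differentiableOn)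
          exact this.const_smul
        · exact hΛi _ (hdiffpow _ _ hd)
  have hΛψ : ∀ φ : ℂ → ℂ, DifferentiableOn ℂ φ (Metric.ball 0 ρ') → Λ (fun ζ => ψ ζ * φ ζ) = 0 := by
    intro φ hφ
    have : Λ (fun ζ => ψ ζ * φ ζ) = ∮ ζ in C(0, ρ), h ζ * φ ζ := by
      refine circleIntegral.integral_congr hρ.le fun ζ hζ => ?_
      have := hψ0 ζ hζ
      simp only
      field_simp
    rw [this]
    have hd : DifferentiableOn ℂ (fun ζ => h ζ * φ ζ) (Metric.ball 0 ρ') := hh.mul hφ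
    refine DiffContOnCl.circleIntegral_eq_zero hρ.le (hd.mono ?_).diffContOnCl
    rw [closure_ball _ hρ.ne']; exact hcb
  have bound : ∀ n : ℕ, ∀ (φ : ℂ → ℂ) (B : ℝ), DifferentiableOn ℂ φ (Metric.ball 0 ρ') →
      (∀ ζ ∈ Metric.sphere (0:ℂ) ρ, ‖φ ζ‖ ≤ B) →
      ‖Λ φ‖ ≤ 2 * Real.pi * ρ * (C * ((ε * (2 / ρ) ^ s) ^ n * B)) := by
    intro n
    induction n with
    | zero => intro φ B _ hB; simpa using hΛb φ B hB
    | succ n ih =>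
      intro φ B hφ hB
      obtain ⟨φ', h1, h2, h3⟩ := shift φ B hφ hB s le_rfl
      have hd : DifferentiableOn ℂ (fun ζ => (ζ ^ s - ψ ζ) * φ' ζ) (Metric.ball 0 ρ') :=
        (((differentiable_id.pow s).differentiableOn).sub hψ).mul h1
      have h4 : Λ (fun ζ => ζ ^ s * φ' ζ) = Λ (fun ζ => (ζ ^ s - ψ ζ) * φ' ζ) := by
        rw [← add_zero (Λ (fun ζ => (ζ ^ s - ψ ζ) * φ' ζ)), ← hΛψ φ' h1]
        simp only [hΛ]
        rw [← circleIntegral.integral_add (hΛi _ hd) (hΛi (fun ζ => ψ ζ * φ' ζ) (hψ.mul h1))]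
        congr 1; ext ζ; ring
      have h5 := ih (fun ζ => (ζ ^ s - ψ ζ) * φ' ζ) (ε * ((2 / ρ) ^ s * B)) hd (by
        intro ζ hζ
        rw [norm_mul, norm_sub_rev]
        exact mul_le_mul (hψε ζ hζ) (h2 ζ hζ) (norm_nonneg _) hε0)
      rw [h3, h4]
      refine h5.trans_eq ?_
      rw [pow_succ]; ring
  have hzero : ∀ φ : ℂ → ℂ, DifferentiableOn ℂ φ (Metric.ball 0 ρ') → Λ φ = 0 := by
    intro φ hφ
    obtain ⟨B, hB⟩ := (isCompact_sphere (0:ℂ) ρ).exists_bound_of_continuousOn (hφ.continuousOn.mono hsb)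
    have ht : Filter.Tendsto (fun n : ℕ => 2 * Real.pi * ρ * (C * ((ε * (2 / ρ) ^ s) ^ n * B)))
        Filter.atTop (nhds (2 * Real.pi * ρ * (C * (0 * B)))) := by
      refine ((((tendsto_pow_atTop_nhds_zero_of_lt_one (by positivity) hε2).mul_const B).const_mul C).const_mul _)
    have := ge_of_tendsto' ht fun n => bound n φ B hφ hB
    simpa using this
  intro z hz hz0
  have hzρ' : Metric.ball (0:ℂ) ρ' ∈ nhds z :=
    Metric.isOpen_ball.mem_nhds (Metric.ball_subset_ball hρ'.le hz)
  have h1 := hzero (dslope ψ z) ((Complex.differentiableOn_dslope hzρ').2 hψ)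
  have h2 : Λ (dslope ψ z) = ∮ ζ in C(0, ρ), (ζ - z)⁻¹ • h ζ := by
    refine circleIntegral.integral_congr hρ.le fun ζ hζ => ?_
    have hne : ζ ≠ z := by
      rintro rfl
      rw [mem_sphere_zero_iff_norm] at hζ
      rw [mem_ball_zero_iff] at hz
      linarith
    have := hψ0 ζ hζ
    simp only [dslope_of_ne _ hne, slope_def_field, hz0, smul_eq_mul]
    have : ζ - z ≠ 0 := sub_ne_zero.2 hne
    field_simp
    simp
  have h3 := DiffContOnCl.circleIntegral_sub_inv_smul (f := h) (R := ρ) (c := 0) (w := z)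
    ((hh.mono (by rw [closure_ball _ hρ.ne']; exact hcb)).diffContOnCl) hz
  rw [← h2, h1] at h3
  have : (2 * Real.pi * Complex.I : ℂ) ≠ 0 := Complex.two_pi_I_ne_zero
  simpa [Real.pi_ne_zero] using h3.symm


theorem analyticAt_det {E : Type} [NormedAddCommGroup E] [NormedSpace ℂ E] {s : ℕ}
    (A : E → Matrix (Fin s) (Fin s) ℂ) (x : E) (hA : ∀ i j, AnalyticAt ℂ (fun y => A y i j) x) :
    AnalyticAt ℂ (fun y => (A y).det) x := by
  simp only [Matrix.det_apply']
  refine Finset.analyticAt_fun_sum _ fun σ _ => ?_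
  exact analyticAt_const.mul (Finset.analyticAt_fun_prod _ fun i _ => hA _ _)

theorem weier {E : Type} [NormedAddCommGroup E] [NormedSpace ℂ E] (f : E × ℂ → ℂ)
    (hf : AnalyticAt ℂ f 0) (hf0 : ¬ ∀ᶠ z in nhds (0:ℂ), f (0, z) = 0) :
    ∃ s : ℕ, ∀ g : E × ℂ → ℂ, AnalyticAt ℂ g 0 → ∃ r : Fin s → E → ℂ, (∀ i, AnalyticAt ℂ (r i) 0) ∧
      ∀ᶠ p in nhds (0 : E × ℂ), f p = 0 → g p = ∑ i, r i p.1 * p.2 ^ (i : ℕ) := by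
  have hf' : AnalyticAt ℂ (fun z : ℂ => f (0, z)) 0 :=
    AnalyticAt.fun_comp (f := fun z : ℂ => ((0 : E), z)) (show AnalyticAt ℂ f (0, 0) from hf) (by fun_prop)
  obtain ⟨s, u, hu, hu0, hfu⟩ := hf'.exists_eventuallyEq_pow_smul_nonzero_iff.2 hf0
  refine ⟨s, fun g hg => ?_⟩
  obtain ⟨Rf, hRf, Hf⟩ := lift_analytic2 f hf
  obtain ⟨Rg, hRg, Hg⟩ := lift_analytic2 g hg
  obtain ⟨ρ₁, hρ₁, h1⟩ := Metric.eventually_nhds_iff_ball.1 (hf.eventually_analyticAt.and hg.eventually_analyticAt)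
  obtain ⟨ρ₂, hρ₂, h2⟩ := Metric.eventually_nhds_iff_ball.1
    ((hu.eventually_analyticAt.and (hu.continuousAt.eventually_ne hu0)).and hfu)
  obtain ⟨ρ', hρ'0, hρ'1, hρ'2⟩ : ∃ ρ' : ℝ, 0 < ρ' ∧ ρ' ≤ ρ₁ ∧ ρ' ≤ ρ₂ :=
    ⟨min ρ₁ ρ₂, by positivity, min_le_left _ _, min_le_right _ _⟩
  obtain ⟨ρ, hρ, hρρ', hρf, hρg⟩ : ∃ ρ : ℝ, 0 < ρ ∧ ρ < ρ' ∧ ρ < Rf ∧ ρ < Rg := by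
    refine ⟨min ρ' (min Rf Rg) / 2, by positivity, ?_, ?_, ?_⟩
    · linarith [min_le_left ρ' (min Rf Rg)]
    · linarith [(min_le_right ρ' (min Rf Rg)).trans (min_le_left Rf Rg), lt_min hρ'0 (lt_min hRf hRg)]
    · linarith [(min_le_right ρ' (min Rf Rg)).trans (min_le_right Rf Rg), lt_min hρ'0 (lt_min hRf hRg)]
  obtain ⟨φf, hφf, hφf'⟩ := Hf ρ hρ hρf
  obtain ⟨φg, hφg, hφg'⟩ := Hg ρ hρ hρg
  obtain ⟨J, hJ⟩ := exists_circCLM ρ hρ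
  have hsph : ∀ ζ : Metric.sphere (0:ℂ) ρ, (ζ : ℂ) ∈ Metric.ball (0:ℂ) ρ₂ := by
    intro ζ
    have : ‖(ζ : ℂ)‖ = ρ := by simp
    rw [mem_ball_zero_iff, this]; linarith
  have hsne : ∀ ζ : Metric.sphere (0:ℂ) ρ, (ζ : ℂ) ≠ 0 := by
    intro ζ h
    have : ‖(ζ : ℂ)‖ = ρ := by simp
    rw [h, norm_zero] at this; linarith
  let uinv : C(Metric.sphere (0:ℂ) ρ, ℂ) := ⟨fun ζ => (u ζ)⁻¹, by
    refine Continuous.inv₀ ?_ fun ζ => (h2 ζ (hsph ζ)).1.2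
    rw [continuous_iff_continuousAt]
    intro ζ
    exact (h2 ζ (hsph ζ)).1.1.continuousAt.comp continuous_subtype_val.continuousAt⟩
  let X : C(Metric.sphere (0:ℂ) ρ, ℂ) := ⟨fun ζ => ζ, continuous_subtype_val⟩
  have hX : ∀ ζ, X ζ = ζ := fun _ => rfl
  have huinv : ∀ ζ, uinv ζ = (u ζ)⁻¹ := fun _ => rfl
  let ψ : E → C(Metric.sphere (0:ℂ) ρ, ℂ) := fun x => φf x * uinv
  have hψ : AnalyticAt ℂ ψ 0 := hφf.mul analyticAt_const
  have hψ0 : ψ 0 = X ^ s := by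
    ext ζ
    have h3 := (h2 ζ (hsph ζ)).2
    have h4 := (h2 ζ (hsph ζ)).1.2
    simp only [ψ, ContinuousMap.mul_apply, hφf'.self_of_nhds ζ, huinv, ContinuousMap.pow_apply, hX]
    rw [h3]; simp [h4]
  have hXunit : IsUnit X := by
    refine IsUnit.of_mul_eq_one (⟨fun ζ => (ζ : ℂ)⁻¹, continuous_subtype_val.inv₀ hsne⟩) ?_
    ext ζ
    exact mul_inv_cancel₀ (hsne ζ)
  have hψunit : IsUnit (ψ 0) := by rw [hψ0]; exact hXunit.pow s
  let I : E → C(Metric.sphere (0:ℂ) ρ, ℂ) := fun x => Ring.inverse (ψ x)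
  have hI : AnalyticAt ℂ I 0 := by
    obtain ⟨w, hw⟩ := hψunit
    have := analyticAt_inverse (𝕜 := ℂ) w
    rw [hw] at this
    exact AnalyticAt.fun_comp this hψ
  have hunit : ∀ᶠ x in nhds 0, IsUnit (ψ x) :=
    hψ.continuousAt.eventually (Units.isOpen.mem_nhds hψunit)
  have hIval : ∀ x, IsUnit (ψ x) → ∀ ζ, I x ζ = (ψ x ζ)⁻¹ := by
    intro x hx ζ
    have := congrArg (fun φ : C(Metric.sphere (0:ℂ) ρ, ℂ) => φ ζ) (Ring.inverse_mul_cancel _ hx)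
    exact eq_inv_of_mul_eq_one_left this
  let A : E → Matrix (Fin s) (Fin s) ℂ := fun x => Matrix.of fun j i =>
    J (I x * X ^ (i : ℕ) * X ^ (s - 1 - j : ℕ))
  let b : E → Fin s → ℂ := fun x j => J (I x * φg x * X ^ (s - 1 - j : ℕ))
  have hA : ∀ j i, AnalyticAt ℂ (fun x => A x j i) 0 := fun j i =>
    AnalyticAt.fun_comp (J.analyticAt _) ((hI.mul analyticAt_const).mul analyticAt_const)
  have hb : ∀ j, AnalyticAt ℂ (fun x => b x j) 0 := fun j =>
    AnalyticAt.fun_comp (J.analyticAt _) ((hI.mul hφg).mul analyticAt_const)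
  have hA0 : A 0 = (2 * Real.pi * Complex.I : ℂ) • (1 : Matrix (Fin s) (Fin s) ℂ) := by
    ext j i
    have hji : A 0 j i = ∮ ζ in C(0, ρ), (ζ - 0) ^ ((i : ℤ) - j - 1) := by
      refine hJ _ _ fun ζ => ?_
      have hz := hsne ζ
      simp only [ContinuousMap.mul_apply, hIval 0 hψunit, hψ0, ContinuousMap.pow_apply, hX, sub_zero]
      rw [← zpow_natCast, ← zpow_natCast, ← zpow_natCast, ← _root_.zpow_neg, ← zpow_add₀ hz, ← zpow_add₀ hz]
      congr 1
      have := j.2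
      omega
    rw [hji, Matrix.smul_apply, Matrix.one_apply, smul_eq_mul]
    split_ifs with h
    · subst h
      have : ((j : ℤ) - j - 1) = -1 := by ring
      rw [this]
      simp only [_root_.zpow_neg_one]
      rw [circleIntegral.integral_sub_center_inv _ hρ.ne', mul_one]
    · rw [circleIntegral.integral_sub_zpow_of_ne, mul_zero]
      intro h'
      apply h
      ext
      omega
  have hdet : AnalyticAt ℂ (fun x => (A x).det) 0 := analyticAt_det A 0 hA
  have hdet0 : (A 0).det ≠ 0 := by
    rw [hA0, Matrix.det_smul, Matrix.det_one, mul_one]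
    exact pow_ne_zero _ Complex.two_pi_I_ne_zero
  let r : Fin s → E → ℂ := fun i x => ((A x).det)⁻¹ * ((A x).updateCol i (b x)).det
  have hr : ∀ i, AnalyticAt ℂ (r i) 0 := by
    intro i
    refine (hdet.inv hdet0).mul (analyticAt_det _ 0 fun j k => ?_)
    by_cases h : k = i
    · subst h; simpa using hb j
    · simpa [Matrix.updateCol_ne h] using hA j k
  refine ⟨r, hr, ?_⟩
  have hε : ∀ᶠ x in nhds 0, ‖ψ x - X ^ s‖ < (ρ / 2) ^ s / 2 := by
    have : Filter.Tendsto (fun x => ‖ψ x - X ^ s‖) (nhds 0) (nhds ‖ψ 0 - X ^ s‖) :=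
      (hψ.continuousAt.sub continuousAt_const).norm
    rw [hψ0, sub_self, norm_zero] at this
    exact this.eventually_lt_const (by positivity)
  have hxsmall : ∀ᶠ x : E in nhds 0, x ∈ Metric.ball 0 ρ' := Metric.ball_mem_nhds _ hρ'0
  have hmain : ∀ᶠ x : E in nhds 0, ∀ z ∈ Metric.ball (0:ℂ) ρ, f (x, z) = 0 →
      g (x, z) = ∑ i, r i x * z ^ (i : ℕ) := by
    filter_upwards [hε, hxsmall, hunit, hφf', hφg', hdet.continuousAt.eventually_ne hdet0]
      with x hx1 hx2 hx3 hx4 hx5 hx6 z hz hfz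
    have hpair : ∀ z ∈ Metric.ball (0:ℂ) ρ', (x, z) ∈ Metric.ball (0 : E × ℂ) ρ₁ := by
      intro z hz
      rw [mem_ball_zero_iff] at *
      rw [Prod.norm_def]
      exact (max_lt hx2 hz).trans_le hρ'1
    have hAr : A x *ᵥ (fun i => r i x) = b x := by
      have : (fun i => r i x) = ((A x).det)⁻¹ • (A x).cramer (b x) := by
        ext i; simp [r, Matrix.cramer_apply]
      rw [this, Matrix.mulVec_smul, Matrix.mulVec_cramer, smul_smul, inv_mul_cancel₀ hx6, one_smul]
    have hpole : ∀ z ∈ Metric.ball (0:ℂ) ρ', DifferentiableAt ℂ (fun z => f (x, z)) z ∧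
        DifferentiableAt ℂ (fun z => g (x, z)) z := by
      intro z hz
      have h3 := h1 _ (hpair z hz)
      have h4 : DifferentiableAt ℂ (fun z : ℂ => (x, z)) z := by fun_prop
      exact ⟨h3.1.differentiableAt.comp z h4, h3.2.differentiableAt.comp z h4⟩
    have key := weier_one ρ ρ' hρ hρρ' s (fun z => f (x, z) * (u z)⁻¹)
      (fun z => g (x, z) - ∑ i, r i x * z ^ (i : ℕ)) ((ρ / 2) ^ s / 2) ?_ ?_ ?_ ?_ ?_ ?_ z hz (by simp [hfz])
    · exact sub_eq_zero.1 key
    · intro z hz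
      have h5 := (h2 z (Metric.ball_subset_ball hρ'2 hz)).1
      exact (((hpole z hz).1.mul (h5.1.differentiableAt.inv h5.2))).differentiableWithinAt
    · intro z hz
      refine ((hpole z hz).2.sub ?_).differentiableWithinAt
      fun_prop
    · have : (ρ / 2) ^ s ≤ ρ ^ s := pow_le_pow_left₀ (by positivity) (by linarith) s
      have : 0 < ρ ^ s := by positivity
      linarith
    · have : (ρ / 2) ^ s / 2 * (2 / ρ) ^ s = 1 / 2 := by
        rw [div_mul_eq_mul_div, ← mul_pow]
        have : ρ / 2 * (2 / ρ) = 1 := by field_simp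
        rw [this, one_pow]
      rw [this]; norm_num
    · intro ζ hζ
      have h6 := (ψ x - X ^ s).norm_coe_le_norm ⟨ζ, hζ⟩
      simp only [ContinuousMap.sub_apply, ContinuousMap.pow_apply, hX, ψ, ContinuousMap.mul_apply, hx4, huinv] at h6
      exact h6.trans hx1.le
    · intro j hj
      have h7 : J (I x * (φg x - ∑ i, (r i x) • X ^ (i : ℕ)) * X ^ j) =
          ∮ ζ in C(0, ρ), (g (x, ζ) - ∑ i, r i x * ζ ^ (i : ℕ)) / (f (x, ζ) * (u ζ)⁻¹) * ζ ^ j := by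
        refine hJ _ _ fun ζ => ?_
        simp only [ContinuousMap.mul_apply, hIval x hx3, ContinuousMap.pow_apply, hX,
          ContinuousMap.sub_apply, ContinuousMap.sum_apply, ContinuousMap.smul_apply, smul_eq_mul, hx5, ψ, hx4, huinv]
        rw [div_eq_inv_mul]
      rw [← h7]
      have h8 := congrFun hAr ⟨s - 1 - j, by omega⟩
      have hj' : s - 1 - (s - 1 - j) = j := by omega
      simp only [Matrix.mulVec, dotProduct, A, b, Matrix.of_apply, hj'] at h8
      have h9 : I x * (φg x - ∑ i, (r i x) • X ^ (i : ℕ)) * X ^ j =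
          I x * φg x * X ^ j - ∑ i, (r i x) • (I x * X ^ (i : ℕ) * X ^ j) := by
        rw [mul_sub, sub_mul, Finset.mul_sum, Finset.sum_mul]
        congr 1
        refine Finset.sum_congr rfl fun i _ => ?_
        rw [mul_smul_comm, smul_mul_assoc]
      rw [h9, map_sub, map_sum, ← h8, sub_eq_zero]
      refine Finset.sum_congr rfl fun i _ => ?_
      rw [map_smul, smul_eq_mul, mul_comm]
  have e1 : ∀ᶠ p : E × ℂ in nhds 0, ∀ z ∈ Metric.ball (0:ℂ) ρ, f (p.1, z) = 0 →
      g (p.1, z) = ∑ i, r i p.1 * z ^ (i : ℕ) :=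
    (continuous_fst.tendsto' (0 : E × ℂ) 0 rfl).eventually hmain
  have e2 : ∀ᶠ p : E × ℂ in nhds 0, p.2 ∈ Metric.ball (0:ℂ) ρ :=
    (continuous_snd.tendsto' (0 : E × ℂ) 0 rfl).eventually (Metric.ball_mem_nhds _ hρ)
  filter_upwards [e1, e2] with p h3 h4 h5
  exact h3 p.2 h4 h5


/-- functions analytic at the origin -/
def anaAlg (E : Type) [NormedAddCommGroup E] [NormedSpace ℂ E] : Subalgebra ℂ (E → ℂ) where
  carrier := {f | AnalyticAt ℂ f 0}
  mul_mem' := fun hf hg => AnalyticAt.mul hf hg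
  add_mem' := fun hf hg => AnalyticAt.add hf hg
  algebraMap_mem' := fun c => show AnalyticAt ℂ (fun _ => c) 0 from analyticAt_const

/-- pullback along a linear map -/
def anaPull {E E' : Type} [NormedAddCommGroup E] [NormedSpace ℂ E] [NormedAddCommGroup E'] [NormedSpace ℂ E']
    (T : E →L[ℂ] E') : anaAlg E' →ₐ[ℂ] anaAlg E where
  toFun := fun a => ⟨fun x => a.1 (T x), by
    have h : AnalyticAt ℂ a.1 (T 0) := by rw [map_zero]; exact a.2
    exact AnalyticAt.fun_comp h (T.analyticAt 0)⟩
  map_one' := rfl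
  map_mul' := fun _ _ => rfl
  map_zero' := rfl
  map_add' := fun _ _ => rfl
  commutes' := fun _ => rfl

theorem exists_line {E : Type} [NormedAddCommGroup E] [NormedSpace ℂ E] (f : E → ℂ)
    (hf : AnalyticAt ℂ f 0) (hf0 : ¬ ∀ᶠ x in nhds 0, f x = 0) :
    ∃ p : E, ¬ ∀ᶠ t in nhds (0:ℂ), f (t • p) = 0 := by
  obtain ⟨R, hR, h⟩ := Metric.eventually_nhds_iff_ball.1 hf.eventually_analyticAt
  have : ∃ p ∈ Metric.ball (0:E) R, f p ≠ 0 := by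
    by_contra! hc
    exact hf0 (Metric.eventually_nhds_iff_ball.2 ⟨R, hR, hc⟩)
  obtain ⟨p, hp, hfp⟩ := this
  refine ⟨p, fun hev => hfp ?_⟩
  let U : Set ℂ := (fun t : ℂ => t • p) ⁻¹' Metric.ball 0 R
  have hU : IsPreconnected U := by
    have : Convex ℝ U := (convex_ball (0:E) R).is_linear_preimage
      (f := fun t : ℂ => t • p) ⟨fun x y => add_smul _ _ _, fun c x => by simp [mul_smul]⟩
    exact this.isPreconnected
  have han : AnalyticOnNhd ℂ (fun t : ℂ => f (t • p)) U := by
    intro t ht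
    exact AnalyticAt.fun_comp (h _ ht) (by fun_prop)
  have := han.eqOn_zero_of_preconnected_of_eventuallyEq_zero hU (z₀ := 0) (by simpa [U] using hR) hev
    (show (1:ℂ) ∈ U by simpa [U] using hp)
  simpa using this

noncomputable def taylorFun (f : ℂ → ℂ) : PowerSeries ℂ :=
  PowerSeries.mk fun n => iteratedDeriv n f 0 / (n.factorial : ℂ)

theorem taylorFun_mul (f g : ℂ → ℂ) (hf : AnalyticAt ℂ f 0) (hg : AnalyticAt ℂ g 0) :
    taylorFun (f * g) = taylorFun f * taylorFun g := by
  ext n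
  rw [PowerSeries.coeff_mul]
  simp only [taylorFun, PowerSeries.coeff_mk]
  have h := iteratedDeriv_fun_mul (n := n) (hf.contDiffAt) (hg.contDiffAt)
  change iteratedDeriv n (f * g) 0 = _ at h
  rw [h, Finset.Nat.sum_antidiagonal_eq_sum_range_succ
    (fun i j => iteratedDeriv i f 0 / (i.factorial : ℂ) * (iteratedDeriv j g 0 / (j.factorial : ℂ))),
    Finset.sum_div]
  refine Finset.sum_congr rfl fun i hi => ?_
  have hi' : i ≤ n := by simpa [Nat.lt_succ_iff] using hi
  rw [Nat.cast_choose ℂ hi']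
  have h1 : (n.factorial : ℂ) ≠ 0 := by exact_mod_cast n.factorial_ne_zero
  have h2 : (i.factorial : ℂ) ≠ 0 := by exact_mod_cast i.factorial_ne_zero
  have h3 : ((n - i).factorial : ℂ) ≠ 0 := by exact_mod_cast (n - i).factorial_ne_zero
  field_simp

noncomputable def taylorHom : anaAlg ℂ →ₐ[ℂ] PowerSeries ℂ where
  toFun := fun f => taylorFun f.1
  map_one' := by
    ext n
    change (PowerSeries.coeff n) (taylorFun (fun _ => 1)) = _
    simp only [taylorFun, PowerSeries.coeff_mk, iteratedDeriv_const, PowerSeries.coeff_one]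
    split_ifs with h
    · simp [h]
    · simp
  map_mul' := fun f g => taylorFun_mul _ _ f.2 g.2
  map_zero' := by
    ext n
    change (PowerSeries.coeff n) (taylorFun (fun _ => 0)) = _
    simp [taylorFun, PowerSeries.coeff_mk]
  map_add' := by
    intro f g
    ext n
    change (PowerSeries.coeff n) (taylorFun (f.1 + g.1)) = _
    have := iteratedDeriv_add (n := n) (x := (0:ℂ)) (f := f.1) (g := g.1) (f.2.contDiffAt) (g.2.contDiffAt)
    simp [taylorFun, PowerSeries.coeff_mk, this, add_div]
  commutes' := by
    intro c
    ext n
    change (PowerSeries.coeff n) (taylorFun (fun _ => c)) = (PowerSeries.coeff n) (PowerSeries.C c)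
    simp only [taylorFun, PowerSeries.coeff_mk, iteratedDeriv_const, PowerSeries.coeff_C]
    split_ifs with h
    · simp [h]
    · simp

theorem taylorHom_eq_zero (f : anaAlg ℂ) : taylorHom f = 0 ↔ ∀ᶠ z in nhds (0:ℂ), f.1 z = 0 := by
  have h1 := AnalyticAt.hasFPowerSeriesAt f.2
  rw [h1.locally_zero_iff, FormalMultilinearSeries.ofScalars_series_eq_zero]
  constructor
  · intro h
    funext n
    have := congrArg (PowerSeries.coeff n) h
    change (PowerSeries.coeff n) (taylorFun f.1) = _ at this
    simp only [taylorFun, PowerSeries.coeff_mk, map_zero] at this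
    rw [this]; rfl
  · intro h
    ext n
    change (PowerSeries.coeff n) (taylorFun f.1) = _
    simp only [taylorFun, PowerSeries.coeff_mk, map_zero]
    exact congrFun h n

theorem ext_integral {A B L : Type} [CommRing A] [CommRing B] [Algebra A B] [Algebra.IsIntegral A B]
    (hinj : Function.Injective (algebraMap A B)) [Field L] [IsAlgClosed L] (χ : A →+* L) :
    ∃ χ' : B →+* L, ∀ a, χ' (algebraMap A B a) = χ a := by
  let q := RingHom.ker χ
  have hq : q.IsPrime := RingHom.ker_isPrime χ
  obtain ⟨Q, -, hQ, hQq⟩ := Ideal.exists_ideal_over_prime_of_isIntegral q (⊥ : Ideal B) (by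
    intro a ha
    have : a = 0 := hinj (by simpa using ha)
    rw [this]; exact q.zero_mem)
  have hlo : Q.LiesOver q := ⟨hQq.symm⟩
  let χ0 : A ⧸ q →+* L := Ideal.Quotient.lift q χ (fun a ha => ha)
  have hχ0 : Function.Injective χ0 := RingHom.lift_injective_of_ker_le_ideal _ _ le_rfl
  let _ : Algebra (A ⧸ q) L := χ0.toAlgebra
  have h1 : Module.IsTorsionFree (A ⧸ q) L :=
    Module.isTorsionFree_iff_algebraMap_injective.2 hχ0
  have h2 : Module.IsTorsionFree (A ⧸ q) (B ⧸ Q) :=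
    Module.isTorsionFree_iff_algebraMap_injective.2 (by
      rw [injective_iff_map_eq_zero]
      intro a
      obtain ⟨a, rfl⟩ := Ideal.Quotient.mk_surjective a
      intro ha
      change Ideal.Quotient.mk Q (algebraMap A B a) = 0 at ha
      rw [Ideal.Quotient.eq_zero_iff_mem, ← Ideal.mem_comap, hQq] at ha
      exact Ideal.Quotient.eq_zero_iff_mem.2 ha)
  have h3 : Algebra.IsAlgebraic (A ⧸ q) (B ⧸ Q) := inferInstance
  let l : (B ⧸ Q) →ₐ[A ⧸ q] L := IsAlgClosed.lift
  refine ⟨l.toRingHom.comp (Ideal.Quotient.mk Q), fun a => ?_⟩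
  have : Ideal.Quotient.mk Q (algebraMap A B a) = algebraMap (A ⧸ q) (B ⧸ Q) (Ideal.Quotient.mk q a) := rfl
  simp only [RingHom.comp_apply, this]
  exact l.commutes _


abbrev LField : Type := AlgebraicClosure (FractionRing (PowerSeries ℂ))

theorem curve_sel_line {E : Type} [NormedAddCommGroup E] [NormedSpace ℂ E]
    (p : E) (h : anaAlg E) (hp : ¬ ∀ᶠ t in nhds (0:ℂ), h.1 (t • p) = 0) :
    ∃ φ : anaAlg E →ₐ[ℂ] LField, (∀ f : anaAlg E, (∀ᶠ x in nhds 0, f.1 x = 0) → φ f = 0) ∧ φ h ≠ 0 ∧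
      ∃ M : IntermediateField (FractionRing (PowerSeries ℂ)) LField,
        FiniteDimensional (FractionRing (PowerSeries ℂ)) M ∧
        ∀ f, φ f ∈ M ∧ IsIntegral (PowerSeries ℂ) (φ f) := by
  let T : ℂ →L[ℂ] E := ContinuousLinearMap.toSpanSingleton ℂ p
  let φ : anaAlg E →ₐ[ℂ] LField :=
    ((IsScalarTower.toAlgHom ℂ (PowerSeries ℂ) LField).comp taylorHom).comp (anaPull T)
  have hφ : ∀ f, φ f = algebraMap (PowerSeries ℂ) LField (taylorHom (anaPull T f)) := fun _ => rfl
  have hinj : Function.Injective (algebraMap (PowerSeries ℂ) LField) := by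
    rw [IsScalarTower.algebraMap_eq (PowerSeries ℂ) (FractionRing (PowerSeries ℂ)) LField]
    exact (algebraMap (FractionRing (PowerSeries ℂ)) LField).injective.comp (IsFractionRing.injective _ _)
  refine ⟨φ, ?_, ?_, ⊥, inferInstance, ?_⟩
  · intro f hf
    rw [hφ, map_eq_zero_iff _ hinj, taylorHom_eq_zero]
    exact (T.continuous.tendsto' 0 0 (map_zero T)).eventually hf
  · rw [hφ, Ne, map_eq_zero_iff _ hinj, taylorHom_eq_zero]
    exact hp
  · intro f
    rw [hφ]
    refine ⟨?_, isIntegral_algebraMap⟩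
    rw [IsScalarTower.algebraMap_apply (PowerSeries ℂ) (FractionRing (PowerSeries ℂ)) LField]
    exact IntermediateField.algebraMap_mem _ _

theorem curve_sel_step {E E' : Type} [NormedAddCommGroup E] [NormedSpace ℂ E]
    [NormedAddCommGroup E'] [NormedSpace ℂ E']
    (ih : ∀ (𝒰 : Ultrafilter E'), (𝒰 : Filter E') ≤ nhds 0 → ∀ h : anaAlg E', (¬ ∀ᶠ x in 𝒰, h.1 x = 0) →
      ∃ φ : anaAlg E' →ₐ[ℂ] LField, (∀ f : anaAlg E', (∀ᶠ x in 𝒰, f.1 x = 0) → φ f = 0) ∧ φ h ≠ 0 ∧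
      ∃ M : IntermediateField (FractionRing (PowerSeries ℂ)) LField,
        FiniteDimensional (FractionRing (PowerSeries ℂ)) M ∧
        ∀ f, φ f ∈ M ∧ IsIntegral (PowerSeries ℂ) (φ f))
    (T : E ≃L[ℂ] E' × ℂ) (𝒰 : Ultrafilter E) (h𝒰 : (𝒰 : Filter E) ≤ nhds 0) (f : anaAlg E)
    (hf : ∀ᶠ x in 𝒰, f.1 x = 0) (hfT : ¬ ∀ᶠ z in nhds (0:ℂ), f.1 (T.symm (0, z)) = 0)
    (h : anaAlg E) (hh : ¬ ∀ᶠ x in 𝒰, h.1 x = 0) :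
    ∃ φ : anaAlg E →ₐ[ℂ] LField, (∀ f : anaAlg E, (∀ᶠ x in 𝒰, f.1 x = 0) → φ f = 0) ∧ φ h ≠ 0 ∧
      ∃ M : IntermediateField (FractionRing (PowerSeries ℂ)) LField,
        FiniteDimensional (FractionRing (PowerSeries ℂ)) M ∧
        ∀ f, φ f ∈ M ∧ IsIntegral (PowerSeries ℂ) (φ f) := by
  let π : E →L[ℂ] E' := (ContinuousLinearMap.fst ℂ E' ℂ).comp (T : E →L[ℂ] E' × ℂ)
  let τ : E →L[ℂ] ℂ := (ContinuousLinearMap.snd ℂ E' ℂ).comp (T : E →L[ℂ] E' × ℂ)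
  let τ' : anaAlg E := ⟨τ, τ.analyticAt 0⟩
  let Tsymm : E' × ℂ →L[ℂ] E := T.symm
  obtain ⟨s, hs⟩ := weier (anaPull Tsymm f).1 (anaPull Tsymm f).2 hfT
  let 𝒰' : Ultrafilter E' := 𝒰.map π
  have h𝒰' : (𝒰' : Filter E') ≤ nhds 0 := by
    have := π.continuous.tendsto' 0 0 (map_zero π)
    exact this.mono_left h𝒰
  have H : ∀ g : anaAlg E, ∃ r : Fin s → anaAlg E', ∀ᶠ x in 𝒰, g.1 x = ∑ i, (r i).1 (π x) * (τ x) ^ (i : ℕ) := by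
    intro g
    obtain ⟨r, hr, hrg⟩ := hs (anaPull Tsymm g).1 (anaPull Tsymm g).2
    refine ⟨fun i => ⟨r i, hr i⟩, ?_⟩
    have h1 := h𝒰 ((T.continuous.tendsto' 0 0 (map_zero T)).eventually hrg)
    filter_upwards [h1, hf] with x hx1 hx2
    have e : ∀ a : anaAlg E, (anaPull Tsymm a).1 (T x) = a.1 x := by
      intro a
      change a.1 (T.symm (T x)) = a.1 x
      rw [T.symm_apply_apply]
    rw [e, e] at hx1
    exact hx1 hx2
  let 𝔽 := (𝒰 : Filter E).Germ ℂ
  let ι : anaAlg E →+* 𝔽 := (Filter.Germ.coeRingHom (𝒰 : Filter E)).comp (anaAlg E).val.toRingHom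
  have hι : ∀ f g : anaAlg E, ι f = ι g ↔ ∀ᶠ x in 𝒰, f.1 x = g.1 x := fun f g => Filter.Germ.coe_eq
  have hι0 : ∀ f : anaAlg E, ι f = 0 ↔ ∀ᶠ x in 𝒰, f.1 x = 0 := by
    intro f
    rw [← map_zero ι]
    exact hι f 0
  let ι' : anaAlg E' →+* 𝔽 := ι.comp (anaPull π).toRingHom
  have hι'0 : ∀ a : anaAlg E', ι' a = 0 ↔ ∀ᶠ x in 𝒰', a.1 x = 0 := fun a => hι0 _
  let θ : 𝔽 := ι τ'
  have Hι : ∀ g : anaAlg E, ∃ r : Fin s → anaAlg E', ι g = ∑ i, ι' (r i) * θ ^ (i : ℕ) := by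
    intro g
    obtain ⟨r, hr⟩ := H g
    refine ⟨r, ?_⟩
    have h2 : ∑ i, ι' (r i) * θ ^ (i : ℕ) = ι (∑ i, anaPull π (r i) * τ' ^ (i : ℕ)) := by
      rw [map_sum]
      refine Finset.sum_congr rfl fun i _ => ?_
      rw [map_mul, map_pow]; rfl
    rw [h2, hι]
    filter_upwards [hr] with x hx
    rw [hx]
    simp only [AddSubmonoidClass.coe_finsetSum, Finset.sum_apply]
    rfl
  let A := ι'.range
  have hθ : IsIntegral A θ := by
    obtain ⟨r, hr⟩ := Hι (τ' ^ s)
    rw [map_pow] at hr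
    let q : Polynomial A := ∑ i : Fin s, Polynomial.C (ι'.rangeRestrict (r i) : A) * Polynomial.X ^ (i : ℕ)
    have hq : q.degree < s := by
      rw [← Polynomial.mem_degreeLT]
      refine Submodule.sum_mem _ fun i _ => ?_
      rw [Polynomial.mem_degreeLT]
      refine lt_of_le_of_lt (Polynomial.degree_C_mul_X_pow_le _ _) ?_
      exact_mod_cast i.2
    refine ⟨Polynomial.X ^ s - q, Polynomial.monic_X_pow_sub hq, ?_⟩
    rw [Polynomial.eval₂_sub, Polynomial.eval₂_X_pow, sub_eq_zero]
    refine Eq.trans hr ?_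
    rw [Polynomial.eval₂_finsetSum]
    refine Finset.sum_congr rfl fun i _ => ?_
    rw [Polynomial.eval₂_mul, Polynomial.eval₂_C, Polynomial.eval₂_X_pow]
    rfl
  let B := Algebra.adjoin A {θ}
  have hB : Algebra.IsIntegral A B := Algebra.IsIntegral.adjoin (by simpa using hθ)
  let θB : B := ⟨θ, Algebra.subset_adjoin rfl⟩
  have hιB : ∀ g, ι g ∈ B := by
    intro g
    obtain ⟨r, hr⟩ := Hι g
    rw [hr]
    refine Subalgebra.sum_mem _ fun i _ => Subalgebra.mul_mem _ ?_ (Subalgebra.pow_mem _ θB.2 _)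
    exact Subalgebra.algebraMap_mem B (ι'.rangeRestrict (r i) : A)
  let ιB : anaAlg E →+* B := ι.codRestrict B hιB
  have hhB : ιB h ≠ 0 := by
    intro h0
    exact hh ((hι0 h).1 (congrArg Subtype.val h0))
  obtain ⟨b, hb0, hb⟩ := ((hB.isIntegral (ιB h)).isAlgebraic).exists_nonzero_dvd (mem_nonZeroDivisors_of_ne_zero hhB)
  obtain ⟨b0, hb0'⟩ := b.2
  obtain ⟨φ', h1, h2, M', hM', h3⟩ := ih 𝒰' h𝒰' b0 (by
    rw [← hι'0, hb0']
    intro h0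
    exact hb0 (Subtype.ext h0))
  have hsurj : Function.Surjective ι'.rangeRestrict := RingHom.rangeRestrict_surjective _
  let χ : A →+* LField := RingHom.liftOfSurjective ι'.rangeRestrict hsurj ⟨φ'.toRingHom, by
    intro a ha
    rw [RingHom.ker_rangeRestrict] at ha
    exact h1 a ((hι'0 a).1 ha)⟩
  have hχ : ∀ a, χ (ι'.rangeRestrict a) = φ' a := fun a =>
    RingHom.liftOfRightInverse_comp_apply _ _ _ _ a
  have hinjAB : Function.Injective (algebraMap A B) := fun a a' hh =>
    Subtype.ext (congrArg (fun b : B => (b : 𝔽)) hh)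
  obtain ⟨χ', hχ'⟩ := ext_integral (A := A) (B := B) (L := LField) hinjAB χ
  have hφ' : ∀ a, χ' (ιB (anaPull π a)) = φ' a := by
    intro a
    rw [← hχ a, ← hχ']
    congr 1
  have hIntg : ∀ b : B, IsIntegral (PowerSeries ℂ) (χ' b) := by
    intro b
    have hAint : ∀ a : A, χ a ∈ (integralClosure (PowerSeries ℂ) LField).toSubring := by
      intro a
      obtain ⟨a0, rfl⟩ := hsurj a
      rw [hχ]
      exact (h3 a0).2
    have := IsIntegral.map_of_comp_eq (S := B) (R := A) (T := integralClosure (PowerSeries ℂ) LField)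
      (χ.codRestrict (integralClosure (PowerSeries ℂ) LField).toSubring hAint) χ'
      (by ext a; exact (hχ' a).symm) (hB.isIntegral b)
    exact isIntegral_trans _ this
  let x : LField := χ' θB
  have hxint : IsIntegral (FractionRing (PowerSeries ℂ)) x := (hIntg θB).tower_top
  let φ : anaAlg E →ₐ[ℂ] LField :=
    { χ'.comp ιB with
      commutes' := fun c => by
        have := hφ' (algebraMap ℂ _ c)
        rw [AlgHom.commutes, AlgHom.commutes] at this
        exact this }
  have hφ : ∀ g, φ g = χ' (ιB g) := fun _ => rfl
  refine ⟨φ, ?_, ?_, M' ⊔ IntermediateField.adjoin _ {x}, ?_, ?_⟩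
  · intro f hf
    have : ιB f = 0 := Subtype.ext ((hι0 f).2 hf)
    rw [hφ, this, map_zero]
  · intro h0
    obtain ⟨e, he⟩ := hb
    apply h2
    have h5 : b = ι'.rangeRestrict b0 := Subtype.ext hb0'.symm
    rw [← hχ, ← h5, ← hχ', he, map_mul, ← hφ, h0, zero_mul]
  · have := IntermediateField.adjoin.finiteDimensional hxint
    exact IntermediateField.finiteDimensional_sup _ _
  · intro g
    refine ⟨?_, hIntg _⟩
    obtain ⟨r, hr⟩ := Hι g
    have h6 : ιB g = ∑ i, ιB (anaPull π (r i)) * θB ^ (i : ℕ) := by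
      apply Subtype.ext
      rw [AddSubmonoidClass.coe_finsetSum]
      exact hr
    rw [hφ, h6, map_sum]
    refine sum_mem fun i _ => ?_
    rw [map_mul, map_pow, hφ']
    refine mul_mem ((le_sup_left : M' ≤ _) (h3 _).1) (pow_mem ?_ _)
    exact (le_sup_right : _ ≤ M' ⊔ IntermediateField.adjoin _ {x}) (IntermediateField.mem_adjoin_simple_self _ x)

theorem curve_sel (n : ℕ) : ∀ (E : Type) [NormedAddCommGroup E] [NormedSpace ℂ E] [FiniteDimensional ℂ E],
    Module.finrank ℂ E = n →
    ∀ (𝒰 : Ultrafilter E), (𝒰 : Filter E) ≤ nhds 0 → ∀ h : anaAlg E, (¬ ∀ᶠ x in 𝒰, h.1 x = 0) →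
      ∃ φ : anaAlg E →ₐ[ℂ] LField, (∀ f : anaAlg E, (∀ᶠ x in 𝒰, f.1 x = 0) → φ f = 0) ∧ φ h ≠ 0 ∧
      ∃ M : IntermediateField (FractionRing (PowerSeries ℂ)) LField,
        FiniteDimensional (FractionRing (PowerSeries ℂ)) M ∧
        ∀ f, φ f ∈ M ∧ IsIntegral (PowerSeries ℂ) (φ f) := by
  induction n with
  | zero =>
    intro E _ _ _ hE 𝒰 h𝒰 h hh
    obtain ⟨p, hp⟩ := exists_line h.1 h.2 (fun h0 => hh (h𝒰 h0))
    obtain ⟨φ, h1, h2, h3⟩ := curve_sel_line p h hp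
    refine ⟨φ, fun f hf => h1 f ?_, h2, h3⟩
    have : Subsingleton E := Module.finrank_zero_iff.1 hE
    obtain ⟨x, hx⟩ := hf.exists
    exact Filter.Eventually.of_forall fun y => Subsingleton.elim x y ▸ hx
  | succ n ih =>
    intro E _ _ _ hE 𝒰 h𝒰 h hh
    by_cases hc : ∀ f : anaAlg E, (∀ᶠ x in 𝒰, f.1 x = 0) → ∀ᶠ x in nhds 0, f.1 x = 0
    · obtain ⟨p, hp⟩ := exists_line h.1 h.2 (fun h0 => hh (h𝒰 h0))
      obtain ⟨φ, h1, h2, h3⟩ := curve_sel_line p h hp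
      exact ⟨φ, fun f hf => h1 f (hc f hf), h2, h3⟩
    · push Not at hc
      obtain ⟨f, hf, hf0⟩ := hc
      obtain ⟨p, hp⟩ := exists_line f.1 f.2 (by simpa using hf0)
      have hf00 : f.1 0 = 0 := by
        have ht : Filter.Tendsto f.1 𝒰 (nhds (f.1 0)) := f.2.continuousAt.tendsto.mono_left h𝒰
        exact tendsto_nhds_unique (ht.congr' hf) tendsto_const_nhds
      have hp0 : p ≠ 0 := by
        rintro rfl
        exact hp (Filter.Eventually.of_forall fun t => by simpa using hf00)
      have T0 : E ≃L[ℂ] (Fin n → ℂ) × ℂ := ContinuousLinearEquiv.ofFinrankEq (by simp [hE])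
      obtain ⟨S, hS⟩ := SeparatingDual.exists_continuousLinearEquiv_apply_eq (R := ℂ)
        (V := (Fin n → ℂ) × ℂ) (x := T0 p) (y := (0, 1)) (by simpa using hp0) (by simp)
      refine curve_sel_step (ih (Fin n → ℂ) (by simp)) (T0.trans S) 𝒰 h𝒰 f hf ?_ h hh
      have : ∀ z : ℂ, (T0.trans S).symm (0, z) = z • p := by
        intro z
        rw [ContinuousLinearEquiv.symm_apply_eq]
        simp [hS]
      simpa only [this] using hp


/-- homomorphisms to a valued differential field, respecting germs at the origin -/
structure GoodHom {E M : Type} [NormedAddCommGroup E] [NormedSpace ℂ E] [Field M] [Algebra ℂ M]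
    (v : Valuation M (WithZero (Multiplicative ℤ))) (δ : Derivation ℂ M M) (ψ : anaAlg E →ₐ[ℂ] M) : Prop where
  ker : ∀ f : anaAlg E, (∀ᶠ x in nhds 0, f.1 x = 0) → ψ f = 0
  le_one : ∀ f, v (ψ f) ≤ 1
  res : ∀ x, v x ≤ 1 → ∃ c : ℂ, v (x - algebraMap ℂ M c) < 1
  d1 : ∀ x, v x ≤ 1 → v (δ x) < 1
  d2 : ∀ x, v x < 1 → v (δ x) = v x

theorem cs_valued {E : Type} [NormedAddCommGroup E] [NormedSpace ℂ E] [FiniteDimensional ℂ E]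
    (𝒰 : Ultrafilter E) (h𝒰 : (𝒰 : Filter E) ≤ nhds 0) (h : anaAlg E) (hh : ¬ ∀ᶠ x in 𝒰, h.1 x = 0) :
    ∃ (M : Type) (_ : Field M) (_ : Algebra ℂ M) (v : Valuation M (WithZero (Multiplicative ℤ)))
      (δ : Derivation ℂ M M) (ψ : anaAlg E →ₐ[ℂ] M), GoodHom v δ ψ ∧
      (∀ f : anaAlg E, (∀ᶠ x in 𝒰, f.1 x = 0) → ψ f = 0) ∧ ψ h ≠ 0 := by
  obtain ⟨φ, h1, h2, M, hM, h3⟩ := curve_sel _ E rfl 𝒰 h𝒰 h hh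
  have t1 : IsScalarTower ℂ (PowerSeries ℂ) M := IsScalarTower.of_algebraMap_eq fun c =>
    Subtype.ext (IsScalarTower.algebraMap_apply ℂ (PowerSeries ℂ) LField c)
  have t2 : IsScalarTower (PowerSeries ℂ) M LField := IsScalarTower.of_algebraMap_eq fun c => rfl
  obtain ⟨v, δ, a1, a2, a3, a4, a5⟩ := exists_valued M
  let ψ : anaAlg E →ₐ[ℂ] M :=
    { φ.toRingHom.codRestrict M (fun f => (h3 f).1) with
      commutes' := fun c => Subtype.ext (φ.commutes c) }
  have hψ : ∀ f, ((ψ f : M) : LField) = φ f := fun _ => rfl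
  have hψ0 : ∀ f, φ f = 0 → ψ f = 0 := fun f hf => Subtype.ext hf
  refine ⟨M, inferInstance, inferInstance, v, δ, ψ, ⟨?_, ?_, a3, a4, a5⟩, ?_, ?_⟩
  · exact fun f hf => hψ0 f (h1 f (h𝒰 hf))
  · intro f
    apply a1
    have := (h3 f).2
    rw [← hψ] at this
    exact (isIntegral_algebraMap_iff (A := M) (B := LField) (algebraMap M LField).injective).1 this
  · exact fun f hf => hψ0 f (h1 f hf)
  · intro h0
    apply h2
    rw [← hψ, h0]; rfl

theorem GoodHom.congr {E M : Type} [NormedAddCommGroup E] [NormedSpace ℂ E] [Field M] [Algebra ℂ M]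
    {v : Valuation M (WithZero (Multiplicative ℤ))} {δ : Derivation ℂ M M} {ψ : anaAlg E →ₐ[ℂ] M}
    (H : GoodHom v δ ψ) (f g : anaAlg E) (hfg : ∀ᶠ x in nhds 0, f.1 x = g.1 x) : ψ f = ψ g := by
  rw [← sub_eq_zero, ← map_sub]
  apply H.ker
  filter_upwards [hfg] with x hx
  change f.1 x - g.1 x = 0
  rw [hx, sub_self]

theorem GoodHom.pull {E E' M : Type} [NormedAddCommGroup E] [NormedSpace ℂ E] [NormedAddCommGroup E']
    [NormedSpace ℂ E'] [Field M] [Algebra ℂ M]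
    {v : Valuation M (WithZero (Multiplicative ℤ))} {δ : Derivation ℂ M M} {ψ : anaAlg E →ₐ[ℂ] M}
    (H : GoodHom v δ ψ) (T : E →L[ℂ] E') : GoodHom v δ (ψ.comp (anaPull T)) :=
  ⟨fun f hf => H.ker _ ((T.continuous.tendsto' 0 0 (map_zero T)).eventually hf), fun f => H.le_one _,
    H.res, H.d1, H.d2⟩

theorem GoodHom.lt_one {E M : Type} [NormedAddCommGroup E] [NormedSpace ℂ E] [Field M] [Algebra ℂ M]
    {v : Valuation M (WithZero (Multiplicative ℤ))} {δ : Derivation ℂ M M} {ψ : anaAlg E →ₐ[ℂ] M}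
    (H : GoodHom v δ ψ) (f : anaAlg E) (hf : f.1 0 = 0) : v (ψ f) < 1 := by
  obtain ⟨c, hc⟩ := H.res _ (H.le_one f)
  by_cases hc0 : c = 0
  · simpa [hc0] using hc
  exfalso
  rw [← ψ.commutes, ← map_sub] at hc
  set g : anaAlg E := f - algebraMap ℂ _ c with hg
  have hgz : ∀ z, g.1 z = f.1 z - c := fun z => rfl
  have hg0 : g.1 0 ≠ 0 := by rw [hgz, hf]; simpa using hc0
  let gi : anaAlg E := ⟨fun z => (g.1 z)⁻¹, g.2.fun_inv hg0⟩
  have h1 : ψ (g * gi) = ψ 1 := by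
    apply H.congr
    filter_upwards [g.2.continuousAt.eventually_ne hg0] with x hx
    exact mul_inv_cancel₀ hx
  have h2 : v (ψ g) * v (ψ gi) = 1 := by rw [← map_mul, ← map_mul, h1, map_one, map_one]
  have h3 : v (ψ g) * v (ψ gi) < 1 := mul_lt_one_of_lt_of_le hc (H.le_one gi)
  exact h3.ne h2

/-- coordinate functions -/
def anaX {n : ℕ} (i : Fin n) : anaAlg (Fin n → ℂ) :=
  ⟨fun z => z i, (ContinuousLinearMap.proj (R := ℂ) (φ := fun _ : Fin n => ℂ) i).analyticAt 0⟩

/-- partial derivatives -/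
noncomputable def anaD {n : ℕ} (m : Fin n) (f : anaAlg (Fin n → ℂ)) : anaAlg (Fin n → ℂ) :=
  ⟨fun z => fderiv ℂ f.1 z (Pi.single m 1),
    ((ContinuousLinearMap.apply ℂ ℂ (Pi.single m 1 : Fin n → ℂ)).analyticAt _).fun_comp f.2.fderiv⟩

theorem hadamard {n : ℕ} (f : anaAlg (Fin n → ℂ)) : ∃ q : Fin n → anaAlg (Fin n → ℂ),
    ∀ᶠ z in nhds 0, f.1 z = f.1 0 + ∑ i, z i * (q i).1 z := by
  obtain ⟨p, r, hp⟩ := f.2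
  have hr : 0 < p.shift.radius := by
    rw [FormalMultilinearSeries.radius_shift]
    exact hp.r_pos.trans_le hp.r_le
  have hq := p.shift.hasFPowerSeriesOnBall hr
  have h2 := hq.unshift (z := f.1 0)
  refine ⟨fun i => ⟨fun z => p.shift.sum z (Pi.single i 1),
    ((ContinuousLinearMap.apply ℂ ℂ (Pi.single i 1 : Fin n → ℂ)).analyticAt _).fun_comp hq.analyticAt⟩, ?_⟩
  have h3 : p.shift.unshift (f.1 0) = p := by
    ext k x
    cases k with
    | zero => 
      rw [← hp.coeff_zero x]; simp [FormalMultilinearSeries.unshift]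
    | succ k => simp [FormalMultilinearSeries.unshift, FormalMultilinearSeries.shift]
  rw [h3] at h2
  have h4 := hp.hasFPowerSeriesAt.eventually_hasSum
  have h5 := h2.hasFPowerSeriesAt.eventually_hasSum
  filter_upwards [h4, h5] with z hz1 hz2
  simp only [zero_add, sub_zero] at hz1 hz2
  rw [hz1.unique hz2]
  congr 1
  conv_lhs => rw [← Finset.univ_sum_single z, map_sum]
  refine Finset.sum_congr rfl fun i _ => ?_
  have : (Pi.single i (z i) : Fin n → ℂ) = z i • Pi.single i 1 := by simp [← Pi.single_smul]
  rw [this, map_smul, smul_eq_mul]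
  congr 3
  simp [Finset.univ_sum_single]


theorem zm_le_exp (x : WithZero (Multiplicative ℤ)) (hx : x < 1) : x ≤ WithZero.exp (-1 : ℤ) := by
  induction x using WithZero.expRecOn with
  | zero => exact zero_le
  | exp a =>
    rw [← WithZero.exp_zero, WithZero.exp_lt_exp] at hx
    rw [WithZero.exp_le_exp]; lia

theorem zm_zero (x : WithZero (Multiplicative ℤ)) (hx : ∀ k : ℕ, x ≤ WithZero.exp (-1 : ℤ) ^ k) : x = 0 := by
  induction x using WithZero.expRecOn with
  | zero => rfl
  | exp a =>
    have := hx (a.natAbs + 1)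
    rw [← WithZero.exp_nsmul, WithZero.exp_le_exp] at this
    simp at this
    have h2 := neg_abs_le a
    exfalso
    linarith

theorem GoodHom.chain {n : ℕ} {M : Type} [Field M] [Algebra ℂ M]
    {v : Valuation M (WithZero (Multiplicative ℤ))} {δ : Derivation ℂ M M} {ψ : anaAlg (Fin n → ℂ) →ₐ[ℂ] M}
    (H : GoodHom v δ ψ) (f : anaAlg (Fin n → ℂ)) : δ (ψ f) = ∑ m, ψ (anaD m f) * δ (ψ (anaX m)) := by
  let D : anaAlg (Fin n → ℂ) → M := fun f => δ (ψ f) - ∑ m, ψ (anaD m f) * δ (ψ (anaX m))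
  have hDle : ∀ f, v (D f) ≤ 1 := by
    intro f
    refine (v.map_sub _ _).trans (max_le (H.d1 _ (H.le_one f)).le ?_)
    refine v.map_sum_le fun m _ => ?_
    rw [map_mul]
    exact mul_le_one' (H.le_one _) (H.d1 _ (H.le_one _)).le
  have hdiff : ∀ f : anaAlg (Fin n → ℂ), ∀ᶠ z in nhds 0, DifferentiableAt ℂ f.1 z := fun f =>
    f.2.eventually_analyticAt.mono fun z hz => hz.differentiableAt
  have hDc : ∀ c : ℂ, D (algebraMap ℂ _ c) = 0 := by
    intro c
    have : ∀ m, ψ (anaD m (algebraMap ℂ _ c)) = 0 := by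
      intro m
      apply H.ker
      refine Filter.Eventually.of_forall fun z => ?_
      change fderiv ℂ (fun _ => c) z _ = 0
      simp
    simp only [D, this, ψ.commutes, Derivation.map_algebraMap]
    simp
  have hDX : ∀ i, D (anaX i) = 0 := by
    intro i
    have : ∀ m, ψ (anaD m (anaX i)) = if m = i then 1 else 0 := by
      intro m
      have h1 : anaD m (anaX i) = if m = i then 1 else 0 := by
        apply Subtype.ext
        funext z
        change fderiv ℂ (ContinuousLinearMap.proj (R := ℂ) (φ := fun _ : Fin n => ℂ) i) z (Pi.single m 1) = _
        rw [ContinuousLinearMap.fderiv]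
        by_cases h : m = i
        · subst h; simp
        · simp [h, Ne.symm h]
      rw [h1]
      split_ifs <;> simp
    simp only [D, this]
    simp
  have hDcongr : ∀ f g : anaAlg (Fin n → ℂ), (∀ᶠ z in nhds 0, f.1 z = g.1 z) → D f = D g := by
    intro f g hfg
    have h1 : ∀ m, ψ (anaD m f) = ψ (anaD m g) := by
      intro m
      apply H.congr
      filter_upwards [Filter.EventuallyEq.fderiv (𝕜 := ℂ) hfg] with z hz
      change fderiv ℂ f.1 z _ = fderiv ℂ g.1 z _
      rw [hz]
    simp only [D, h1, H.congr f g hfg]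
  have hDadd : ∀ f g, D (f + g) = D f + D g := by
    intro f g
    have h1 : ∀ m, ψ (anaD m (f + g)) = ψ (anaD m f) + ψ (anaD m g) := by
      intro m
      rw [← map_add]
      apply H.congr
      filter_upwards [hdiff f, hdiff g] with z hz1 hz2
      change fderiv ℂ (f.1 + g.1) z _ = fderiv ℂ f.1 z _ + fderiv ℂ g.1 z _
      rw [fderiv_add hz1 hz2]; rfl
    simp only [D, h1, map_add, add_mul, Finset.sum_add_distrib]
    ring
  have hDmul : ∀ f g, D (f * g) = ψ f * D g + ψ g * D f := by
    intro f g
    have h1 : ∀ m, ψ (anaD m (f * g)) = ψ f * ψ (anaD m g) + ψ g * ψ (anaD m f) := by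
      intro m
      rw [← map_mul, ← map_mul, ← map_add]
      apply H.congr
      filter_upwards [hdiff f, hdiff g] with z hz1 hz2
      change fderiv ℂ (f.1 * g.1) z _ = f.1 z * fderiv ℂ g.1 z _ + g.1 z * fderiv ℂ f.1 z _
      rw [fderiv_mul hz1 hz2]; rfl
    simp only [D, h1, map_mul, Derivation.leibniz, add_mul, Finset.sum_add_distrib, smul_eq_mul,
      mul_assoc, ← Finset.mul_sum]
    ring
  have hDsum : ∀ (q : Fin n → anaAlg (Fin n → ℂ)), D (∑ i, q i) = ∑ i, D (q i) := by
    intro q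
    have h0 : D 0 = 0 := by simpa using hDc 0
    exact map_sum (AddMonoidHom.mk (ZeroHom.mk D h0) hDadd) q Finset.univ
  have key : ∀ k : ℕ, ∀ f, v (D f) ≤ WithZero.exp (-1 : ℤ) ^ k := by
    intro k
    induction k with
    | zero => simpa using hDle
    | succ k ih =>
      intro f
      obtain ⟨q, hq⟩ := hadamard f
      have h1 : D f = D (algebraMap ℂ _ (f.1 0) + ∑ i, anaX i * q i) := by
        apply hDcongr
        filter_upwards [hq] with z hz
        rw [hz]
        simp only [AddMemClass.coe_add, AddSubmonoidClass.coe_finsetSum, Pi.add_apply, Finset.sum_apply]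
        rfl
      rw [h1, hDadd, hDc, zero_add, hDsum]
      refine v.map_sum_le fun i _ => ?_
      rw [hDmul, hDX, mul_zero, add_zero, map_mul, pow_succ']
      exact mul_le_mul' (zm_le_exp _ (H.lt_one _ rfl)) (ih _)
  have := zm_zero _ fun k => key k f
  rw [map_eq_zero] at this
  exact sub_eq_zero.1 this


theorem caseA {d g : ℕ} (𝒰 : Ultrafilter (Fin d → ℂ)) (h𝒰 : (𝒰 : Filter (Fin d → ℂ)) ≤ nhds 0)
    (e : anaAlg (Fin d → ℂ)) (he0 : e.1 0 = 0) (f : Fin g → anaAlg (Fin d → ℂ))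
    (he : ∀ᶠ z in 𝒰, e.1 z ≠ 0) (u0 : Fin g → ℂ)
    (hu : Filter.Tendsto (fun z j => (f j).1 z / e.1 z) 𝒰 (nhds u0))
    (nn : Fin d → Fin g → ℂ) (hn : ∀ m, ∑ j, nn m j * u0 j = 0)
    (b : Fin d → Fin g → anaAlg (Fin d → ℂ))
    (hode : ∀ m, ∀ᶠ z in 𝒰, z m * fderiv ℂ e.1 z (Pi.single m 1) =
      ∑ j, nn m j * (f j).1 z + z m * ∑ j, (b m j).1 z * (f j).1 z) : False := by
  let κ : (Fin d → ℂ) → (Fin d → ℂ) × (Fin g → ℂ) := fun z => (z, (fun j => (f j).1 z / e.1 z) - u0)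
  let 𝒱 := 𝒰.map κ
  have h𝒱 : (𝒱 : Filter ((Fin d → ℂ) × (Fin g → ℂ))) ≤ nhds 0 := by
    have h1 : Filter.Tendsto κ 𝒰 (nhds (0, u0 - u0)) :=
      Filter.Tendsto.prodMk_nhds h𝒰 (hu.sub tendsto_const_nhds)
    rw [sub_self] at h1
    exact h1
  let P : anaAlg (Fin d → ℂ) →ₐ[ℂ] anaAlg ((Fin d → ℂ) × (Fin g → ℂ)) := anaPull (ContinuousLinearMap.fst ℂ _ _)
  let Q : anaAlg (Fin g → ℂ) →ₐ[ℂ] anaAlg ((Fin d → ℂ) × (Fin g → ℂ)) := anaPull (ContinuousLinearMap.snd ℂ _ _)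
  obtain ⟨M, _, _, v, δ, ψ, H, hker, hne⟩ := cs_valued 𝒱 h𝒱 (P e) (by
    intro h0
    have h0' : ∀ᶠ z in 𝒰, e.1 z = 0 := h0
    obtain ⟨z, hz1, hz2⟩ := (he.and h0').exists
    exact hz1 hz2)
  have HX : GoodHom v δ (ψ.comp P) := H.pull _
  have HY : GoodHom v δ (ψ.comp Q) := H.pull _
  set ψX := ψ.comp P with hψX
  set ψY := ψ.comp Q with hψY
  have hne' : ψX e ≠ 0 := hne
  have hve : v (ψX e) < 1 := HX.lt_one e he0
  have hve0 : v (ψX e) ≠ 0 := (v.ne_zero_iff).2 hne'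
  have hf : ∀ j, ψX (f j) = (algebraMap ℂ M (u0 j) + ψY (anaX j)) * ψX e := by
    intro j
    have h1 : ψ (P (f j) - (algebraMap ℂ _ (u0 j) + Q (anaX j)) * P e) = 0 := by
      apply hker
      have : ∀ᶠ z in 𝒰, (f j).1 z - (u0 j + ((f j).1 z / e.1 z - u0 j)) * e.1 z = 0 := by
        filter_upwards [he] with z hz
        field_simp
        ring
      exact this
    rw [map_sub, map_mul, map_add, AlgHom.commutes, sub_eq_zero] at h1
    exact h1
  have hfle : ∀ j, v (ψX (f j)) ≤ v (ψX e) := by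
    intro j
    have : ψX (f j) = ψY (algebraMap ℂ _ (u0 j) + anaX j) * ψX e := by
      rw [hf, map_add, AlgHom.commutes]
    rw [this, map_mul]
    exact mul_le_of_le_one_left' (HY.le_one _)
  have hsum : ∀ m, v (ψX (∑ j, algebraMap ℂ _ (nn m j) * f j)) < v (ψX e) := by
    intro m
    have : ψX (∑ j, algebraMap ℂ _ (nn m j) * f j) = ψY (∑ j, algebraMap ℂ _ (nn m j) * anaX j) * ψX e := by
      simp only [map_sum, map_mul, AlgHom.commutes, hf]
      have h2 : ∑ j, algebraMap ℂ M (nn m j) * algebraMap ℂ M (u0 j) = 0 := by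
        simp only [← map_mul, ← map_sum, hn, map_zero]
      have h3 : ∀ j, algebraMap ℂ M (nn m j) * ((algebraMap ℂ M (u0 j) + ψY (anaX j)) * ψX e) =
        algebraMap ℂ M (nn m j) * algebraMap ℂ M (u0 j) * ψX e + algebraMap ℂ M (nn m j) * ψY (anaX j) * ψX e :=
        fun j => by ring
      simp only [h3, Finset.sum_add_distrib, ← Finset.sum_mul, h2]
      ring
    rw [this, map_mul]
    refine mul_lt_of_lt_one_left (zero_lt_iff.2 hve0) (HY.lt_one _ ?_)
    simp only [AddSubmonoidClass.coe_finsetSum, Finset.sum_apply]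
    refine Finset.sum_eq_zero fun j _ => ?_
    change nn m j * (0 : Fin g → ℂ) j = 0
    simp
  have hsum2 : ∀ m, v (ψX (anaX m * ∑ j, b m j * f j)) < v (ψX e) := by
    intro m
    rw [map_mul, map_mul]
    refine lt_of_le_of_lt (mul_le_mul' le_rfl ?_) (mul_lt_of_lt_one_left (zero_lt_iff.2 hve0) (HX.lt_one (anaX m) rfl))
    rw [map_sum]
    refine v.map_sum_le fun j _ => ?_
    rw [map_mul, map_mul]
    exact (mul_le_of_le_one_left' (HX.le_one _)).trans (hfle j)
  have hterm : ∀ m, v (ψX (anaD m e) * δ (ψX (anaX m))) < v (ψX e) := by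
    intro m
    rw [map_mul, HX.d2 _ (HX.lt_one (anaX m) rfl), ← map_mul, ← map_mul]
    have : ψX (anaD m e * anaX m) = ψX (∑ j, algebraMap ℂ _ (nn m j) * f j) + ψX (anaX m * ∑ j, b m j * f j) := by
      rw [← map_add, ← sub_eq_zero, ← map_sub]
      apply hker
      have : ∀ᶠ z in 𝒰, (anaD m e * anaX m - (∑ j, algebraMap ℂ _ (nn m j) * f j + anaX m * ∑ j, b m j * f j)).1 z = 0 := by
        filter_upwards [hode m] with z hz
        have h1 : (anaD m e * anaX m - (∑ j, algebraMap ℂ _ (nn m j) * f j + anaX m * ∑ j, b m j * f j)).1 z =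
          fderiv ℂ e.1 z (Pi.single m 1) * z m - (∑ j, nn m j * (f j).1 z + z m * ∑ j, (b m j).1 z * (f j).1 z) := by
          have s1 : (∑ j, algebraMap ℂ (anaAlg (Fin d → ℂ)) (nn m j) * f j).1 z = ∑ j, nn m j * (f j).1 z := by
            rw [AddSubmonoidClass.coe_finsetSum, Finset.sum_apply]; rfl
          have s2 : (∑ j, b m j * f j).1 z = ∑ j, (b m j).1 z * (f j).1 z := by
            rw [AddSubmonoidClass.coe_finsetSum, Finset.sum_apply]; rfl
          rw [← s1, ← s2]; rfl
        rw [h1, ← hz]; ring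
      exact this
    rw [this]
    exact (v.map_add _ _).trans_lt (max_lt (hsum m) (hsum2 m))
  have h1 : v (δ (ψX e)) < v (ψX e) := by
    rw [HX.chain e]
    exact v.map_sum_lt hve0 fun m _ => hterm m
  exact h1.ne (HX.d2 _ hve)


theorem exists_minor {d g : ℕ} (A : Matrix (Fin g) (Fin d) ℂ) (hA : A.rank = d) :
    ∃ σ : Fin d → Fin g, (A.submatrix σ id).det ≠ 0 := by
  obtain ⟨f, hf1, -, hf2⟩ := Submodule.exists_fun_fin_finrank_span_eq ℂ (Set.range A.row)
  have hr : d = Module.finrank ℂ (Submodule.span ℂ (Set.range A.row)) := by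
    rw [← Matrix.rank_eq_finrank_span_row, hA]
  choose σ hσ using hf1
  refine ⟨fun i => σ (Fin.cast hr i), ?_⟩
  have h1 : LinearIndependent ℂ (A.submatrix (fun i => σ (Fin.cast hr i)) id).row := by
    have := hf2.comp (Fin.cast hr) (Fin.cast_injective hr)
    have h2 : (A.submatrix (fun i => σ (Fin.cast hr i)) id).row = f ∘ Fin.cast hr :=
      funext fun i => hσ _
    rw [h2]
    exact this
  rw [Matrix.linearIndependent_rows_iff_isUnit, Matrix.isUnit_iff_isUnit_det] at h1
  exact h1.ne_zero

theorem caseB {d g : ℕ} (𝒰 : Ultrafilter (Fin d → ℂ)) (h𝒰 : (𝒰 : Filter (Fin d → ℂ)) ≤ nhds 0)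
    (k0 : Fin d) (hk0 : ∀ᶠ z : Fin d → ℂ in 𝒰, z k0 ≠ 0) (f : Fin g → anaAlg (Fin d → ℂ))
    (hf : ∀ j, ∀ᶠ z in 𝒰, (f j).1 z = 0)
    (hrank : ∀ᶠ z in 𝒰, (Matrix.of fun (i : Fin g) (m : Fin d) => fderiv ℂ (f i).1 z (Pi.single m 1)).rank = d) :
    False := by
  have h1 : ∀ᶠ z in 𝒰, ∃ σ : Fin d → Fin g,
      ((Matrix.of fun (i : Fin g) (m : Fin d) => fderiv ℂ (f i).1 z (Pi.single m 1)).submatrix σ id).det ≠ 0 :=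
    hrank.mono fun z hz => exists_minor _ hz
  rw [Ultrafilter.eventually_exists_iff] at h1
  obtain ⟨σ, hσ⟩ := h1
  let A : Matrix (Fin d) (Fin d) (anaAlg (Fin d → ℂ)) := Matrix.of fun i m => anaD m (f (σ i))
  have hA : ∀ z, A.det.1 z =
      ((Matrix.of fun (i : Fin g) (m : Fin d) => fderiv ℂ (f i).1 z (Pi.single m 1)).submatrix σ id).det := by
    intro z
    let ev : anaAlg (Fin d → ℂ) →+* ℂ := (Pi.evalRingHom (fun _ => ℂ) z).comp (anaAlg (Fin d → ℂ)).val.toRingHom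
    exact ev.map_det A
  obtain ⟨M, _, _, v, δ, ψ, H, hker, hne⟩ := cs_valued 𝒰 h𝒰 (A.det * anaX k0) (by
    intro h0
    obtain ⟨z, hz1, hz2, hz3⟩ := (hk0.and (hσ.and h0)).exists
    rw [← hA] at hz2
    exact mul_ne_zero hz2 hz1 hz3)
  rw [map_mul] at hne
  have hdet : (ψ.mapMatrix A).det ≠ 0 := by
    rw [← AlgHom.map_det]; exact left_ne_zero_of_mul hne
  have hw : (ψ.mapMatrix A) *ᵥ (fun m => δ (ψ (anaX m))) = 0 := by
    funext i
    have := H.chain (f (σ i))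
    rw [hker _ (hf _), map_zero] at this
    exact this.symm
  have hw0 := congrFun (Matrix.eq_zero_of_mulVec_eq_zero hdet hw) k0
  have h2 := H.d2 _ (H.lt_one (anaX k0) rfl)
  rw [show δ (ψ (anaX k0)) = 0 from hw0, map_zero] at h2
  exact right_ne_zero_of_mul hne ((map_eq_zero v).1 h2.symm)


theorem ultra_lim {α X : Type} [PseudoMetricSpace X] [ProperSpace X] (𝒰 : Ultrafilter α) (f : α → X) (x0 : X) (r : ℝ)
    (h : ∀ᶠ a in 𝒰, dist (f a) x0 ≤ r) : ∃ x, Filter.Tendsto f 𝒰 (nhds x) := by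
  obtain ⟨x, -, hx⟩ := (isCompact_closedBall x0 r).ultrafilter_le_nhds' (𝒰.map f) h
  exact ⟨x, hx⟩

theorem dot_le {g : ℕ} (x y : Fin g → ℝ) (C D : ℝ) (hx : ∀ i, |x i| ≤ C) (hy : ∀ i, |y i| ≤ D) (hC : 0 ≤ C) :
    -(x ⬝ᵥ y) ≤ g * (C * D) := by
  rw [dotProduct, ← Finset.sum_neg_distrib]
  have : ∀ i ∈ Finset.univ, -(x i * y i) ≤ C * D := fun i _ => by
    refine (neg_le_abs _).trans ?_
    rw [abs_mul]
    exact mul_le_mul (hx i) (hy i) (abs_nonneg _) hC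
  have := Finset.sum_le_sum this
  simpa using this

theorem ratio_limit {α : Type} (𝒰 : Ultrafilter α) {g c : ℕ} (x : α → Fin g → ℝ)
    (A : α → Matrix (Fin g) (Fin g) ℝ) (A0 : Matrix (Fin g) (Fin g) ℝ) (hA : Filter.Tendsto A 𝒰 (nhds A0))
    (N : Fin c → Matrix (Fin g) (Fin g) ℝ) (hN : ∀ k, (N k).PosSemidef) (M : ℝ)
    (hA0 : ∀ y : Fin g → ℝ, y ≠ 0 → 0 < y ⬝ᵥ A0 *ᵥ y + M * ∑ k, y ⬝ᵥ N k *ᵥ y)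
    (L : Fin c → α → ℝ) (hL : ∀ k, Filter.Tendsto (L k) 𝒰 Filter.atTop)
    (E : α → Fin g → ℂ)
    (hE : ∀ᶠ a in 𝒰, ∀ i, (E a i).im = -((A a *ᵥ x a) i + ∑ k, L k a * (N k *ᵥ x a) i))
    (hx : ∀ᶠ a in 𝒰, x a ≠ 0) :
    ∃ (i0 : Fin g) (u0 : Fin g → ℂ), (∀ᶠ a in 𝒰, E a i0 ≠ 0) ∧
      Filter.Tendsto (fun a j => (x a j : ℂ) / E a i0) 𝒰 (nhds u0) ∧
      ∀ k i, ∑ j, (N k i j : ℂ) * u0 j = 0 := by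
  have hg : Nonempty (Fin g) := by
    obtain ⟨a, ha⟩ := hx.exists
    obtain ⟨i, -⟩ := Function.ne_iff.1 ha
    exact ⟨i⟩
  let s : α → ℝ := fun a => ‖x a‖
  have hs : ∀ᶠ a in 𝒰, 0 < s a := hx.mono fun a ha => norm_pos_iff.2 ha
  let y : α → Fin g → ℝ := fun a => (s a)⁻¹ • x a
  have hy1 : ∀ᶠ a in 𝒰, ‖y a‖ = 1 := hs.mono fun a ha => by
    simp only [y, norm_smul, norm_inv, Real.norm_eq_abs, abs_of_pos ha]
    exact inv_mul_cancel₀ ha.ne'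
  have hxy : ∀ᶠ a in 𝒰, x a = s a • y a := hs.mono fun a ha => by
    simp only [y, smul_smul, mul_inv_cancel₀ ha.ne', one_smul]
  obtain ⟨y0, hy0⟩ := ultra_lim 𝒰 y 0 1 (hy1.mono fun a ha => by rw [dist_zero_right, ha])
  have hy0n : ‖y0‖ = 1 := tendsto_nhds_unique ((hy0.norm).congr' hy1) tendsto_const_nhds
  have hy0ne : y0 ≠ 0 := by rw [← norm_pos_iff, hy0n]; exact one_pos
  have hquad : ∀ (B : α → Matrix (Fin g) (Fin g) ℝ) (B0 : Matrix (Fin g) (Fin g) ℝ),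
      Filter.Tendsto B 𝒰 (nhds B0) → Filter.Tendsto (fun a => y a ⬝ᵥ B a *ᵥ y a) 𝒰 (nhds (y0 ⬝ᵥ B0 *ᵥ y0)) := by
    intro B B0 hB
    have hc : Continuous fun p : Matrix (Fin g) (Fin g) ℝ × (Fin g → ℝ) => p.2 ⬝ᵥ p.1 *ᵥ p.2 := by fun_prop
    exact (hc.tendsto (B0, y0)).comp (hB.prodMk_nhds hy0)
  have hT : Filter.Tendsto (fun a => y a ⬝ᵥ A a *ᵥ y a + M * ∑ k, y a ⬝ᵥ N k *ᵥ y a) 𝒰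
      (nhds (y0 ⬝ᵥ A0 *ᵥ y0 + M * ∑ k, y0 ⬝ᵥ N k *ᵥ y0)) :=
    (hquad A A0 hA).add ((tendsto_finsetSum _ fun k _ => hquad _ _ tendsto_const_nhds).const_mul M)
  obtain ⟨δ, hδ, hδ'⟩ := exists_between (hA0 y0 hy0ne)
  have hδev := hT.eventually (lt_mem_nhds hδ')
  have hnn : ∀ k (w : Fin g → ℝ), 0 ≤ w ⬝ᵥ N k *ᵥ w := fun k w => by
    simpa using (hN k).dotProduct_mulVec_nonneg w
  have hLM : ∀ᶠ a in 𝒰, ∀ k, 0 < L k a - M := by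
    rw [Filter.eventually_all]
    intro k
    filter_upwards [(hL k).eventually (Filter.eventually_gt_atTop M)] with a ha
    linarith
  have main : ∀ᶠ a in 𝒰, δ * s a + ∑ k, (L k a - M) * (s a * (y a ⬝ᵥ N k *ᵥ y a)) ≤ g * ‖E a‖ := by
    filter_upwards [hE, hδev, hLM, hs, hy1, hxy] with a h1 h2 h3 h4 h5 h6
    have h7 := dot_le (y a) (fun i => (E a i).im) 1 ‖E a‖
      (fun i => by rw [← h5]; exact norm_le_pi_norm (y a) i)
      (fun i => (Complex.abs_im_le_norm _).trans (norm_le_pi_norm (E a) i)) zero_le_one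
    rw [one_mul] at h7
    refine le_trans ?_ h7
    have h8 : (fun i => (E a i).im) = -(s a • (A a *ᵥ y a + ∑ k, L k a • (N k *ᵥ y a))) := by
      funext i
      rw [h1, h6]
      simp only [Matrix.mulVec_smul, Pi.smul_apply, Pi.neg_apply, Pi.add_apply, Finset.sum_apply, smul_eq_mul,
        mul_add, Finset.mul_sum]
      congr 2
      refine Finset.sum_congr rfl fun k _ => by ring
    rw [h8, dotProduct_neg, neg_neg, dotProduct_smul, dotProduct_add, dotProduct_sum, smul_eq_mul]
    simp only [dotProduct_smul, smul_eq_mul]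
    have h9 : ∑ k, (L k a - M) * (s a * (y a ⬝ᵥ N k *ᵥ y a)) =
      s a * (∑ k, L k a * (y a ⬝ᵥ N k *ᵥ y a) - M * ∑ k, y a ⬝ᵥ N k *ᵥ y a) := by
      rw [Finset.mul_sum, ← Finset.sum_sub_distrib, Finset.mul_sum]
      refine Finset.sum_congr rfl fun k _ => by ring
    rw [h9]
    nlinarith [mul_le_mul_of_nonneg_left h2.le h4.le]
  have main1 : ∀ᶠ a in 𝒰, δ * s a ≤ g * ‖E a‖ := by
    filter_upwards [main, hLM, hs] with a h1 h2 h3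
    have : 0 ≤ ∑ k, (L k a - M) * (s a * (y a ⬝ᵥ N k *ᵥ y a)) :=
      Finset.sum_nonneg fun k _ => mul_nonneg (h2 k).le (mul_nonneg h3.le (hnn _ _))
    linarith
  have main2 : ∀ k, ∀ᶠ a in 𝒰, (L k a - M) * (s a * (y a ⬝ᵥ N k *ᵥ y a)) ≤ g * ‖E a‖ := by
    intro k
    filter_upwards [main, hLM, hs] with a h1 h2 h3
    have := Finset.single_le_sum (f := fun k => (L k a - M) * (s a * (y a ⬝ᵥ N k *ᵥ y a)))
      (fun k _ => mul_nonneg (h2 k).le (mul_nonneg h3.le (hnn _ _))) (Finset.mem_univ k)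
    have h5 := mul_pos hδ h3
    linarith
  have hi0 : ∀ᶠ a in 𝒰, ∃ i0, ‖E a i0‖ = ‖E a‖ := by
    refine Filter.Eventually.of_forall fun a => ?_
    obtain ⟨i, hi⟩ := Finite.exists_max (fun i => ‖E a i‖)
    exact ⟨i, le_antisymm (norm_le_pi_norm _ _) ((pi_norm_le_iff_of_nonneg (norm_nonneg _)).2 hi)⟩
  rw [Ultrafilter.eventually_exists_iff] at hi0
  obtain ⟨i0, hi0⟩ := hi0
  have hEpos : ∀ᶠ a in 𝒰, 0 < ‖E a i0‖ := by
    filter_upwards [main1, hi0, hs] with a h1 h2 h3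
    rw [h2]
    have := mul_pos hδ h3
    by_contra hc
    have h0 : ‖E a‖ = 0 := le_antisymm (not_lt.1 hc) (norm_nonneg _)
    rw [h0] at h1
    linarith
  have hbd : ∀ᶠ a in 𝒰, ‖(s a : ℂ) / E a i0‖ ≤ g / δ := by
    filter_upwards [main1, hi0, hs, hEpos] with a h1 h2 h3 h4
    rw [norm_div, Complex.norm_real, Real.norm_eq_abs, abs_of_pos h3, div_le_div_iff₀ h4 hδ, h2]
    linarith
  obtain ⟨l, hl⟩ := ultra_lim 𝒰 (fun a => (s a : ℂ) / E a i0) 0 (g / δ)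
    (hbd.mono fun a ha => by rwa [dist_zero_right])
  have hz : ∀ k, ‖l‖ * (y0 ⬝ᵥ N k *ᵥ y0) = 0 := by
    intro k
    have t1 : Filter.Tendsto (fun a => ‖(s a : ℂ) / E a i0‖ * (y a ⬝ᵥ N k *ᵥ y a)) 𝒰
        (nhds (‖l‖ * (y0 ⬝ᵥ N k *ᵥ y0))) := hl.norm.mul (hquad _ _ tendsto_const_nhds)
    have t2 : Filter.Tendsto (fun a => (g : ℝ) / (L k a - M)) 𝒰 (nhds 0) :=
      Filter.Tendsto.const_div_atTop (Filter.tendsto_atTop_add_const_right _ (-M) (hL k)) _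
    refine tendsto_nhds_unique t1 (squeeze_zero' (Filter.Eventually.of_forall fun a =>
      mul_nonneg (norm_nonneg _) (hnn _ _)) ?_ t2)
    filter_upwards [main2 k, hLM, hs, hEpos, hi0] with a h1 h2 h3 h4 h5
    rw [norm_div, Complex.norm_real, Real.norm_eq_abs, abs_of_pos h3, div_mul_eq_mul_div,
      div_le_div_iff₀ h4 (h2 k), h5]
    linarith
  refine ⟨i0, fun j => l * (y0 j : ℂ), hEpos.mono fun a ha => norm_pos_iff.1 ha, ?_, ?_⟩
  · have t1 : Filter.Tendsto (fun a j => (s a : ℂ) / E a i0 * (y a j : ℂ)) 𝒰 (nhds fun j => l * (y0 j : ℂ)) := by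
      rw [tendsto_pi_nhds]
      intro j
      exact hl.mul ((Complex.continuous_ofReal.tendsto _).comp (((continuous_apply j).tendsto _).comp hy0))
    refine t1.congr' ?_
    filter_upwards [hxy] with a h1
    funext j
    have : x a j = s a * y a j := congrFun h1 j
    rw [this]
    push_cast
    ring
  · intro k i
    rcases mul_eq_zero.1 (hz k) with h | h
    · simp [norm_eq_zero.1 h]
    · have h1 : N k *ᵥ y0 = 0 := ((hN k).dotProduct_mulVec_zero_iff y0).1 (by simpa using h)
      have h2 : ∑ j, N k i j * y0 j = 0 := congrFun h1 i
      have h3 : ∑ j, (N k i j : ℂ) * (l * (y0 j : ℂ)) = l * ((∑ j, N k i j * y0 j : ℝ) : ℂ) := by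
        push_cast
        rw [Finset.mul_sum]
        refine Finset.sum_congr rfl fun j _ => by ring
      rw [h3, h2]; simp


theorem psd_aux {c d : ℕ} (hcd : c ≤ d) (w : (Fin d → ℂ) → ℂ)
    (hw : AnalyticOnNhd ℂ w {z | ∀ i, ‖z i‖ < 1}) (n : Fin c → ℝ)
    (h : ∀ z : Fin d → ℂ, (∀ i, ‖z i‖ < 1) → (∀ k : Fin c, z (Fin.castLE hcd k) ≠ 0) →
      0 < (w z).im - ∑ k, Real.log ‖z (Fin.castLE hcd k)‖ / (2 * Real.pi) * n k) (k : Fin c) : 0 ≤ n k := by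
  by_contra! hn
  let p : ℝ → Fin d → ℂ := fun t => Function.update (fun _ => (1/2 : ℂ)) (Fin.castLE hcd k) (t : ℂ)
  have hp : Continuous p := by
    exact continuous_const.update _ Complex.continuous_ofReal
  have hp0 : p 0 ∈ {z : Fin d → ℂ | ∀ i, ‖z i‖ < 1} := by
    intro i
    by_cases hi : i = Fin.castLE hcd k
    · subst hi; simp [p]
    · simp [p, hi]; norm_num
  have t1 : Filter.Tendsto (fun t => (w (p t)).im) (nhdsWithin 0 (Ioi 0)) (nhds (w (p 0)).im) := by
    have := (Complex.continuous_im.continuousAt.comp ((hw _ hp0).continuousAt.comp_of_eq hp.continuousAt rfl))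
    exact this.tendsto.mono_left nhdsWithin_le_nhds
  let S : ℝ := ∑ l ∈ Finset.univ.erase k, Real.log (1/2) / (2 * Real.pi) * n l
  have t2 : Filter.Tendsto (fun t => Real.log t * (-(n k) / (2 * Real.pi))) (nhdsWithin 0 (Ioi 0)) Filter.atBot :=
    Real.tendsto_log_nhdsGT_zero.atBot_mul_const (by have := Real.pi_pos; have : 0 < - n k := by linarith
                                                     positivity)
  have t3 := Filter.Tendsto.add_atBot (t1.sub_const S) t2
  obtain ⟨t, ht1, ht2, ht3⟩ := (t3.eventually (Filter.eventually_lt_atBot 0)).and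
    ((Ioo_mem_nhdsGT (zero_lt_one (α := ℝ))) : ∀ᶠ t in nhdsWithin (0:ℝ) (Ioi 0), t ∈ Ioo (0:ℝ) 1) |>.exists
  have hcast : ∀ l : Fin c, l ≠ k → Fin.castLE hcd l ≠ Fin.castLE hcd k := fun l hl hh =>
    hl (Fin.castLE_injective hcd hh)
  have h1 := h (p t) (by
    intro i
    by_cases hi : i = Fin.castLE hcd k
    · subst hi; simp [p, abs_of_pos ht2, ht3]
    · simp [p, hi]; norm_num) (by
    intro l
    by_cases hl : l = k
    · subst hl; simp [p, ht2.ne']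
    · simp [p, hcast l hl])
  rw [← Finset.add_sum_erase _ _ (Finset.mem_univ k)] at h1
  have h2 : ∑ l ∈ Finset.univ.erase k, Real.log ‖p t (Fin.castLE hcd l)‖ / (2 * Real.pi) * n l = S := by
    refine Finset.sum_congr rfl fun l hl => ?_
    simp [p, hcast l (Finset.ne_of_mem_erase hl)]
  have h3 : ‖p t (Fin.castLE hcd k)‖ = t := by simp [p, abs_of_pos ht2]
  rw [h2, h3] at h1
  have h4 : Real.log t * (-(n k) / (2 * Real.pi)) = - (Real.log t / (2 * Real.pi) * n k) := by ring
  rw [h4] at ht1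
  linarith

theorem pos_aux {c d : ℕ} (hcd : c ≤ d) (w : (Fin d → ℂ) → ℂ)
    (hw : AnalyticOnNhd ℂ w {z | ∀ i, ‖z i‖ < 1}) (n : Fin c → ℝ)
    (h : ∀ z : Fin d → ℂ, (∀ i, ‖z i‖ < 1) → (∀ k : Fin c, z (Fin.castLE hcd k) ≠ 0) →
      0 < (w z).im - ∑ k, Real.log ‖z (Fin.castLE hcd k)‖ / (2 * Real.pi) * n k) :
    0 < (w 0).im + Real.log 2 / (2 * Real.pi) * ∑ k, n k := by
  let f : ℂ → ℂ := fun t => Complex.exp (Complex.I * w (fun _ => t))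
  have hf : ∀ t : ℂ, ‖t‖ < 1 → DifferentiableAt ℂ f t := by
    intro t ht
    have h1 : DifferentiableAt ℂ w (fun _ => t) := (hw (fun _ => t) fun _ => ht).differentiableAt
    have h2 : DifferentiableAt ℂ (fun s : ℂ => (fun _ : Fin d => s)) t := by fun_prop
    exact ((h1.comp t h2).const_mul Complex.I).cexp
  have hcl : closure (Metric.ball (0:ℂ) (1/2)) = Metric.closedBall 0 (1/2) := closure_ball _ (by norm_num)
  have hfr : frontier (Metric.ball (0:ℂ) (1/2)) = Metric.sphere 0 (1/2) := frontier_ball _ (by norm_num)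
  have hd : DiffContOnCl ℂ f (Metric.ball 0 (1/2)) := by
    apply DifferentiableOn.diffContOnCl
    rw [hcl]
    intro t ht
    refine (hf t ?_).differentiableWithinAt
    rw [mem_closedBall_zero_iff] at ht
    linarith
  obtain ⟨t, ht, hmax⟩ := Complex.exists_mem_frontier_isMaxOn_norm (Metric.isBounded_ball)
    ⟨0, by simp⟩ hd
  rw [hfr, mem_sphere_zero_iff_norm] at ht
  have h0 : ‖f 0‖ ≤ ‖f t‖ := hmax (by rw [hcl]; simp)
  simp only [f, Complex.norm_exp, Real.exp_le_exp] at h0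
  simp at h0
  have h1 := h (fun _ => t) (fun _ => by rw [ht]; norm_num) (fun _ => by
    rw [← norm_pos_iff, ht]; norm_num)
  simp only [ht] at h1
  rw [← Finset.mul_sum, show Real.log (1/2) = - Real.log 2 by rw [one_div, Real.log_inv]] at h1
  have h2 : (fun _ => 0 : Fin d → ℂ) = 0 := rfl
  rw [h2] at h0
  have h3 : -Real.log 2 / (2 * Real.pi) = -(Real.log 2 / (2 * Real.pi)) := by ring
  rw [h3] at h1
  linarith


/-- Claim 4.2 in the trivial-singularity case (§4.2): with `F`, `G` holomorphic on the
unit polydisc `Δ^d`, `η` holomorphic symmetric, `𝒩¹,…,𝒩^c` real symmetric, the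
differential equation (i), positive definiteness (ii) of
`Im η - Σ (log|z_k|/2π) 𝒩^k`, and the maximal rank condition (iii) on the Jacobian of
`F` imply that the real regulator conditions `Im F = 0` and
`Im G - Σ (log|z_k|/2π) 𝒩^k Re F = 0` have no solution in `U` close to the origin. -/
theorem stmt_12 (c d g : ℕ) (hc : 1 ≤ c) (hcd : c ≤ d) (hdg : d ≤ g)
    (Δ : Set (Fin d → ℂ)) (hΔ : Δ = {z | ∀ i, ‖z i‖ < 1})
    (U : Set (Fin d → ℂ))
    (hU : U = {z ∈ Δ | ∀ k : Fin c, z (Fin.castLE hcd k) ≠ 0})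
    (F G : (Fin d → ℂ) → Fin g → ℂ)
    (η : (Fin d → ℂ) → Matrix (Fin g) (Fin g) ℂ)
    (N : Fin c → Matrix (Fin g) (Fin g) ℝ)
    (hF : AnalyticOnNhd ℂ F Δ) (hG : AnalyticOnNhd ℂ G Δ)
    (hη : ∀ i j : Fin g, AnalyticOnNhd ℂ (fun w => η w i j) Δ)
    (hηs : ∀ z ∈ Δ, (η z).IsSymm) (hNs : ∀ k, (N k).IsSymm)
    (hode : ∀ z ∈ U, ∀ m : Fin d,
      (fun i => fderiv ℂ (fun w => G w i) z (Pi.single m 1)) +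
        (if h : (m : ℕ) < c then
          (1 / (2 * (Real.pi : ℂ) * Complex.I * z m)) •
            ((N ⟨m, h⟩).map (Complex.ofReal)).mulVec (F z)
        else 0)
      = (η z).mulVec (fun j => fderiv ℂ (fun w => F w j) z (Pi.single m 1)))
    (hpos : ∀ z ∈ U,
      (((η z).map Complex.im) -
        ∑ k : Fin c, (Real.log ‖z (Fin.castLE hcd k)‖ / (2 * Real.pi)) • N k).PosDef)
    (hrank : ∀ z ∈ U,
      (Matrix.of fun (i : Fin g) (m : Fin d) =>
        fderiv ℂ (fun w => F w i) z (Pi.single m 1)).rank = d) :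
    ∃ r ∈ Ioo (0 : ℝ) 1, ∀ z ∈ U, (∀ i, ‖z i‖ < r) →
      ¬ ((∀ i, (F z i).im = 0) ∧
        (fun i => (G z i).im) -
          ∑ k : Fin c, (Real.log ‖z (Fin.castLE hcd k)‖ / (2 * Real.pi)) •
            (N k).mulVec (fun j => (F z j).re) = (0 : Fin g → ℝ)) := by
  by_contra hcon
  push Not at hcon
  have h0Δ : (0 : Fin d → ℂ) ∈ Δ := by rw [hΔ]; intro i; simp
  -- the ultrafilter of zeros
  let Z : Set (Fin d → ℂ) := {z | z ∈ U ∧ ((∀ i, (F z i).im = 0) ∧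
        (fun i => (G z i).im) -
          ∑ k : Fin c, (Real.log ‖z (Fin.castLE hcd k)‖ / (2 * Real.pi)) •
            (N k).mulVec (fun j => (F z j).re) = (0 : Fin g → ℝ))}
  have hZ : (nhds (0 : Fin d → ℂ) ⊓ Filter.principal Z).NeBot := by
    rw [← Filter.frequently_mem_iff_neBot, Metric.nhds_basis_ball.frequently_iff]
    intro r hr
    obtain ⟨z, hz, hzr, h1, h2⟩ := hcon (min r (1/2)) ⟨by positivity, (min_le_right _ _).trans_lt (by norm_num)⟩
    refine ⟨z, ?_, hz, h1, h2⟩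
    rw [mem_ball_zero_iff, pi_norm_lt_iff hr]
    exact fun i => (hzr i).trans_le (min_le_left _ _)
  obtain ⟨𝒰, h𝒰⟩ := Ultrafilter.exists_le (nhds (0 : Fin d → ℂ) ⊓ Filter.principal Z)
  have h𝒰0 : (𝒰 : Filter (Fin d → ℂ)) ≤ nhds 0 := h𝒰.trans inf_le_left
  have hUZ : ∀ᶠ z in 𝒰, z ∈ Z := Filter.le_principal_iff.1 (h𝒰.trans inf_le_right)
  have hUU : ∀ᶠ z in 𝒰, z ∈ U := hUZ.mono fun z hz => hz.1
  have hUne : ∀ k : Fin c, ∀ᶠ z : Fin d → ℂ in 𝒰, z (Fin.castLE hcd k) ≠ 0 := by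
    intro k
    filter_upwards [hUU] with z hz
    rw [hU] at hz
    exact hz.2 k
  -- analytic data
  have hFj : ∀ j, AnalyticAt ℂ (fun z => F z j) 0 := fun j => analyticAt_pi_iff.1 (hF 0 h0Δ) j
  have hGj : ∀ j, AnalyticAt ℂ (fun z => G z j) 0 := fun j => analyticAt_pi_iff.1 (hG 0 h0Δ) j
  have hηij : ∀ i j, AnalyticAt ℂ (fun z => η z i j) 0 := fun i j => hη i j 0 h0Δ
  let f : Fin g → anaAlg (Fin d → ℂ) := fun j => ⟨fun z => F z j - F 0 j, (hFj j).fun_sub analyticAt_const⟩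
  have han : ∀ q : (Fin d → ℂ) → ℂ, AnalyticAt ℂ q 0 → ∀ m : Fin d,
      AnalyticAt ℂ (fun z => fderiv ℂ q z (Pi.single m 1)) 0 := fun q hq m => (anaD m ⟨q, hq⟩).2
  -- the equation multiplied out
  have hNF : ∀ (k : Fin c) (i : Fin g), ∃ q : (Fin d → ℂ) → ℂ, AnalyticAt ℂ q 0 ∧
      ∀ z ∈ U, ∑ j, (N k i j : ℂ) * F z j = z (Fin.castLE hcd k) * q z := by
    intro k i
    refine ⟨fun z => (2 * (Real.pi : ℂ) * Complex.I) *
      (∑ j, η z i j * fderiv ℂ (fun w => F w j) z (Pi.single (Fin.castLE hcd k) 1) -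
        fderiv ℂ (fun w => G w i) z (Pi.single (Fin.castLE hcd k) 1)), ?_, ?_⟩
    · refine analyticAt_const.fun_mul (AnalyticAt.fun_sub ?_ (han _ (hGj i) _))
      refine Finset.analyticAt_fun_sum _ fun j _ => ?_
      exact (hηij i j).fun_mul (han _ (hFj j) _)
    · intro z hz
      have h1 := congrFun (hode z hz (Fin.castLE hcd k)) i
      have hk : ((Fin.castLE hcd k : Fin d) : ℕ) < c := k.2
      rw [dif_pos hk] at h1
      have hz0 : z (Fin.castLE hcd k) ≠ 0 := by rw [hU] at hz; exact hz.2 k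
      have hkk : (⟨((Fin.castLE hcd k : Fin d) : ℕ), hk⟩ : Fin c) = k := rfl
      rw [hkk] at h1
      simp only [Pi.add_apply, Pi.smul_apply, smul_eq_mul, Matrix.mulVec, dotProduct, Matrix.map_apply] at h1
      beta_reduce
      rw [← h1]
      have := Complex.I_ne_zero
      have : (Real.pi : ℂ) ≠ 0 := by exact_mod_cast Real.pi_ne_zero
      field_simp
      ring
  have hcontF : ∀ j, Filter.Tendsto (fun z => F z j) 𝒰 (nhds (F 0 j)) := fun j =>
    (hFj j).continuousAt.tendsto.mono_left h𝒰0
  have hcontG : ∀ j, Filter.Tendsto (fun z => G z j) 𝒰 (nhds (G 0 j)) := fun j =>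
    (hGj j).continuousAt.tendsto.mono_left h𝒰0
  have hcoord : ∀ m : Fin d, Filter.Tendsto (fun z : Fin d → ℂ => z m) 𝒰 (nhds 0) := fun m =>
    ((continuous_apply m).tendsto' 0 0 rfl).mono_left h𝒰0
  have hNF0 : ∀ k i, ∑ j, (N k i j : ℂ) * F 0 j = 0 := by
    intro k i
    obtain ⟨q, hq, hq2⟩ := hNF k i
    have t1 : Filter.Tendsto (fun z => ∑ j, (N k i j : ℂ) * F z j) 𝒰 (nhds (∑ j, (N k i j : ℂ) * F 0 j)) :=
      tendsto_finsetSum _ fun j _ => (hcontF j).const_mul _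
    have t2 : Filter.Tendsto (fun z => z (Fin.castLE hcd k) * q z) 𝒰 (nhds (0 * q 0)) :=
      (hcoord _).mul (hq.continuousAt.tendsto.mono_left h𝒰0)
    rw [zero_mul] at t2
    exact tendsto_nhds_unique (t1.congr' (hUU.mono hq2)) t2
  have hF0im : ∀ j, (F 0 j).im = 0 := by
    intro j
    have t1 := (Complex.continuous_im.tendsto _).comp (hcontF j)
    exact tendsto_nhds_unique (t1.congr' (hUZ.mono fun z hz => hz.2.1 j)) tendsto_const_nhds
  -- the second vanishing condition
  have hGim : ∀ᶠ z in 𝒰, ∀ i, (G z i).im = ∑ k : Fin c, Real.log ‖z (Fin.castLE hcd k)‖ / (2 * Real.pi) *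
      ∑ j, N k i j * (F z j).re := by
    filter_upwards [hUZ] with z hz i
    have := congrFun hz.2.2 i
    simp only [Pi.sub_apply, Finset.sum_apply, Pi.smul_apply, smul_eq_mul, Pi.zero_apply, sub_eq_zero] at this
    exact this
  have hG0im : ∀ i, (G 0 i).im = 0 := by
    intro i
    have t1 := (Complex.continuous_im.tendsto _).comp (hcontG i)
    refine tendsto_nhds_unique (t1.congr' (hGim.mono fun z hz => hz i)) ?_
    rw [show (0:ℝ) = ∑ k : Fin c, 0 by simp]
    refine tendsto_finsetSum _ fun k _ => ?_
    obtain ⟨q, hq, hq2⟩ := hNF k i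
    have t2 : Filter.Tendsto (fun z : Fin d → ℂ => ‖z (Fin.castLE hcd k)‖ * Real.log ‖z (Fin.castLE hcd k)‖ *
        ((2 * Real.pi)⁻¹ * ‖q z‖)) 𝒰 (nhds (0 * ((2 * Real.pi)⁻¹ * ‖q 0‖))) := by
      refine Filter.Tendsto.mul ?_ ((hq.continuousAt.tendsto.mono_left h𝒰0).norm.const_mul _)
      have := Real.continuous_mul_log.tendsto' 0 0 (by simp)
      refine this.comp ?_
      simpa using (hcoord (Fin.castLE hcd k)).norm
    rw [zero_mul] at t2
    refine squeeze_zero_norm' ?_ (by simpa using t2.norm)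
    filter_upwards [hUU] with z hz
    have h1 : ∑ j, N k i j * (F z j).re = (z (Fin.castLE hcd k) * q z).re := by
      rw [← hq2 z hz]; simp
    rw [h1]
    simp only [norm_mul, norm_div, norm_norm, Real.norm_eq_abs, abs_norm, norm_inv, abs_mul, abs_div, abs_inv]
    have h2 : |(z (Fin.castLE hcd k) * q z).re| ≤ ‖z (Fin.castLE hcd k)‖ * ‖q z‖ :=
      (Complex.abs_re_le_norm _).trans (norm_mul _ _).le
    calc _ ≤ |Real.log ‖z (Fin.castLE hcd k)‖| / (|2| * |Real.pi|) * (‖z (Fin.castLE hcd k)‖ * ‖q z‖) := by gcongr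
      _ = _ := by
        rw [abs_of_pos (zero_lt_two (α := ℝ))]
        field_simp
  -- positivity
  have hquad : ∀ x : Fin g → ℝ, x ≠ 0 → ∀ z : Fin d → ℂ, (∀ i, ‖z i‖ < 1) →
      (∀ k : Fin c, z (Fin.castLE hcd k) ≠ 0) →
      0 < (∑ i, ∑ j, (x i : ℂ) * (η z i j * (x j : ℂ))).im -
        ∑ k, Real.log ‖z (Fin.castLE hcd k)‖ / (2 * Real.pi) * (x ⬝ᵥ N k *ᵥ x) := by
    intro x hx z hz1 hz2
    have h1 := (hpos z (by rw [hU, hΔ]; exact ⟨hz1, hz2⟩)).dotProduct_mulVec_pos hx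
    rw [Matrix.sub_mulVec, dotProduct_sub, Matrix.sum_mulVec, dotProduct_sum] at h1
    simp only [star_trivial, Matrix.smul_mulVec, dotProduct_smul, smul_eq_mul] at h1
    refine h1.trans_eq ?_
    congr 1
    simp only [dotProduct, Matrix.mulVec, Matrix.map_apply, Finset.mul_sum, Complex.im_sum]
    refine Finset.sum_congr rfl fun i _ => Finset.sum_congr rfl fun j _ => ?_
    simp
  have hqan : ∀ x : Fin g → ℝ, AnalyticOnNhd ℂ (fun z => ∑ i, ∑ j, (x i : ℂ) * (η z i j * (x j : ℂ)))
      {z | ∀ i, ‖z i‖ < 1} := by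
    intro x z hz
    rw [← hΔ] at hz
    refine Finset.analyticAt_fun_sum _ fun i _ => Finset.analyticAt_fun_sum _ fun j _ => ?_
    exact analyticAt_const.fun_mul ((hη i j z hz).fun_mul analyticAt_const)
  have hNpsd : ∀ k, (N k).PosSemidef := by
    intro k
    refine Matrix.PosSemidef.of_dotProduct_mulVec_nonneg ?_ fun x => ?_
    · have := hNs k
      rw [Matrix.IsHermitian, Matrix.conjTranspose_eq_transpose_of_trivial]
      exact this
    · by_cases hx : x = 0
      · simp [hx]
      · simpa using psd_aux hcd _ (hqan x) (fun k => x ⬝ᵥ N k *ᵥ x) (hquad x hx) k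
  have hA0 : ∀ x : Fin g → ℝ, x ≠ 0 → 0 < x ⬝ᵥ ((η 0).map Complex.im) *ᵥ x +
      Real.log 2 / (2 * Real.pi) * ∑ k, x ⬝ᵥ N k *ᵥ x := by
    intro x hx
    refine (pos_aux hcd _ (hqan x) (fun k => x ⬝ᵥ N k *ᵥ x) (hquad x hx)).trans_eq ?_
    congr 1
    simp only [dotProduct, Matrix.mulVec, Matrix.map_apply, Finset.mul_sum, Complex.im_sum]
    refine Finset.sum_congr rfl fun i _ => Finset.sum_congr rfl fun j _ => ?_
    simp
  -- the dichotomy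
  by_cases hx : ∀ᶠ z in 𝒰, ∀ j, (F z j - F 0 j).re = 0
  · -- F is constant along the ultrafilter
    refine caseB 𝒰 h𝒰0 (Fin.castLE hcd ⟨0, hc⟩) (hUne _) f ?_ ?_
    · intro j
      filter_upwards [hx, hUZ] with z hz1 hz2
      refine Complex.ext (hz1 j) ?_
      change (F z j - F 0 j).im = 0
      rw [Complex.sub_im, hz2.2.1 j, hF0im, sub_zero]
    · filter_upwards [hUU] with z hz
      refine Eq.trans ?_ (hrank z hz)
      congr 1
      ext i m
      change fderiv ℂ (fun w => F w i - F 0 i) z _ = _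
      rw [fderiv_sub_const]; rfl
  · let x : (Fin d → ℂ) → Fin g → ℝ := fun z j => (F z j - F 0 j).re
    have hxne : ∀ᶠ z in 𝒰, x z ≠ 0 := by
      rw [← Ultrafilter.eventually_not] at hx
      filter_upwards [hx] with z hz h0
      exact hz fun j => congrFun h0 j
    have hxF : ∀ᶠ z in 𝒰, ∀ j, (x z j : ℂ) = F z j - F 0 j := by
      filter_upwards [hUZ] with z hz j
      apply Complex.ext
      · simp [x]
      · simp [hz.2.1 j, hF0im]
    let E : Fin g → anaAlg (Fin d → ℂ) := fun i => ⟨fun z => G z i - G 0 i - ∑ j, η z i j * (F z j - F 0 j), by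
      refine ((hGj i).fun_sub analyticAt_const).fun_sub ?_
      exact Finset.analyticAt_fun_sum _ fun j _ => (hηij i j).fun_mul (f j).2⟩
    have hA : Filter.Tendsto (fun z => (η z).map Complex.im) 𝒰 (nhds ((η 0).map Complex.im)) := by
      refine tendsto_pi_nhds.2 fun i => tendsto_pi_nhds.2 fun j => ?_
      exact (Complex.continuous_im.tendsto _).comp ((hηij i j).continuousAt.tendsto.mono_left h𝒰0)
    obtain ⟨i0, u0, h1, h2, h3⟩ := ratio_limit 𝒰 x (fun z => (η z).map Complex.im) _ hA N hNpsd _ hA0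
      (fun k z => -Real.log ‖z (Fin.castLE hcd k)‖ / (2 * Real.pi)) (by
        intro k
        refine Filter.Tendsto.atTop_div_const (by have := Real.pi_pos; positivity) ?_
        refine Filter.tendsto_neg_atBot_atTop.comp ?_
        refine Real.tendsto_log_nhdsNE_zero.comp ?_
        rw [tendsto_nhdsWithin_iff]
        refine ⟨by simpa using (hcoord (Fin.castLE hcd k)).norm, ?_⟩
        filter_upwards [hUne k] with z hz
        simpa using hz) (fun z i => (E i).1 z) (by
        filter_upwards [hxF, hGim] with z h1 h2 i
        change (G z i - G 0 i - ∑ j, η z i j * (F z j - F 0 j)).im = _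
        simp only [← h1]
        rw [Complex.sub_im, Complex.sub_im, hG0im, sub_zero, h2, neg_add, sub_eq_neg_add]
        congr 1
        · simp [Matrix.mulVec, dotProduct, Complex.im_sum]
        · rw [← Finset.sum_neg_distrib]
          refine Finset.sum_congr rfl fun k _ => ?_
          have h4 : ∑ j, N k i j * (F z j).re = (N k *ᵥ x z) i := by
            have h5 := congrArg Complex.re (hNF0 k i)
            simp only [Complex.re_sum, Complex.re_ofReal_mul, Complex.zero_re] at h5
            simp only [Matrix.mulVec, dotProduct, x, Complex.sub_re, mul_sub, Finset.sum_sub_distrib, h5, sub_zero]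
          rw [h4]
          ring) hxne
    refine caseA 𝒰 h𝒰0 (E i0) (by simp [E]) f h1 u0 ?_
      (fun m j => if h : (m : ℕ) < c then -(1 / (2 * (Real.pi : ℂ) * Complex.I)) * (N ⟨m, h⟩ i0 j : ℂ) else 0) ?_
      (fun m j => - anaD m ⟨fun z => η z i0 j, hηij i0 j⟩) ?_
    · refine h2.congr' ?_
      filter_upwards [hxF] with z hz
      funext j
      rw [hz]
    · intro m
      by_cases hm : (m : ℕ) < c
      · simp only [dif_pos hm, mul_assoc, ← Finset.mul_sum, h3, mul_zero]
      · simp [hm]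
    · intro m
      filter_upwards [hUU] with z hz
      have hzΔ : z ∈ Δ := by rw [hU] at hz; exact hz.1
      have dF : ∀ j, DifferentiableAt ℂ (fun w => F w j) z := fun j =>
        (analyticAt_pi_iff.1 (hF z hzΔ) j).differentiableAt
      have dG : DifferentiableAt ℂ (fun w => G w i0) z :=
        (analyticAt_pi_iff.1 (hG z hzΔ) i0).differentiableAt
      have dη : ∀ j, DifferentiableAt ℂ (fun w => η w i0 j) z := fun j => (hη i0 j z hzΔ).differentiableAt
      have hder : fderiv ℂ (E i0).1 z (Pi.single m 1) = fderiv ℂ (fun w => G w i0) z (Pi.single m 1) -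
          ∑ j, (η z i0 j * fderiv ℂ (fun w => F w j) z (Pi.single m 1) +
            (F z j - F 0 j) * fderiv ℂ (fun w => η w i0 j) z (Pi.single m 1)) := by
        have hd : HasFDerivAt (E i0).1 (fderiv ℂ (fun w => G w i0) z -
          ∑ j, (η z i0 j • fderiv ℂ (fun w => F w j) z + (F z j - F 0 j) • fderiv ℂ (fun w => η w i0 j) z)) z := by
          refine (dG.hasFDerivAt.sub_const _).fun_sub (HasFDerivAt.fun_sum fun j _ => ?_)
          exact (dη j).hasFDerivAt.fun_mul ((dF j).hasFDerivAt.sub_const _)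
        rw [hd.fderiv]
        simp
      have ho := congrFun (hode z hz m) i0
      simp only [Pi.add_apply] at ho
      have hb : ∀ j, (-anaD m (⟨fun z => η z i0 j, hηij i0 j⟩ : anaAlg (Fin d → ℂ))).1 z =
        -fderiv ℂ (fun w => η w i0 j) z (Pi.single m 1) := fun j => rfl
      have hfz : ∀ j, (f j).1 z = F z j - F 0 j := fun j => rfl
      simp only [hb, hfz]
      rw [hder, Finset.sum_add_distrib]
      have ho' : ∑ j, η z i0 j * fderiv ℂ (fun w => F w j) z (Pi.single m 1) = _ := ho.symm
      rw [ho']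
      have hs : ∑ j, -fderiv ℂ (fun w => η w i0 j) z (Pi.single m 1) * (F z j - F 0 j) =
        - ∑ j, (F z j - F 0 j) * fderiv ℂ (fun w => η w i0 j) z (Pi.single m 1) := by
        rw [← Finset.sum_neg_distrib]
        refine Finset.sum_congr rfl fun j _ => by ring
      rw [hs]
      by_cases hm : (m : ℕ) < c
      · simp only [dif_pos hm, Pi.smul_apply, smul_eq_mul, Matrix.mulVec, dotProduct, Matrix.map_apply]
        have hz0 : z m ≠ 0 := by rw [hU] at hz; exact hz.2 ⟨m, hm⟩
        have hsum : ∑ j, -(1 / (2 * (Real.pi : ℂ) * Complex.I)) * (N ⟨m, hm⟩ i0 j : ℂ) * (F z j - F 0 j) =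
          -(1 / (2 * (Real.pi : ℂ) * Complex.I)) * ∑ j, (N ⟨m, hm⟩ i0 j : ℂ) * F z j := by
          simp only [mul_assoc, ← Finset.mul_sum, mul_sub, Finset.sum_sub_distrib, hNF0, mul_zero, sub_zero]
        rw [hsum]
        have := Complex.I_ne_zero
        have : (Real.pi : ℂ) ≠ 0 := by exact_mod_cast Real.pi_ne_zero
        field_simp
        ring
      · simp only [dif_neg hm, Pi.zero_apply]
        simp
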